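/- arXiv:1802.09041 — 10 statements merged into one kernel-verified Lean document; each statement's English description precedes it below -/
import Mathlib

section
/- Let H be a separable complex Hilbert space and let (μ_j)_{j∈ℕ} and μ be Borel probability measures on H, each concentrated on the closed unit ball X₁. If the characteristic functions converge pointwise, i.e. for every y ∈ H one has ∫ exp(−i·Re⟨x,y⟩) dμ_j(x) → ∫ exp(−i·Re⟨x,y⟩) dμ(x) as j → ∞, then μ_j converges weakly narrowly to μ, i.e. ∫ f dμ_j → ∫ f dμ for every bounded function f : H → ℝ that is continuous with respect to the weak topology of H. -/
open MeasureTheory Filter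
open scoped InnerProductSpace

/-- If `g` and `p` are `ε`-close on a set of full measure, so are their integrals. -/
theorem norm_integral_sub_integral_le {H : Type*} [MeasurableSpace H] {m : Measure H} [IsProbabilityMeasure m]
    {s : Set H} (hs : MeasurableSet s) (hm : m s = 1) {g p : H → ℂ} (hg : Integrable g m)
    (hp : Integrable p m) {ε : ℝ} (h : ∀ x ∈ s, ‖g x - p x‖ ≤ ε) :
    ‖∫ x, g x ∂m - ∫ x, p x ∂m‖ ≤ ε := by
  rw [← integral_sub hg hp]
  have hae : ∀ᵐ x ∂m, ‖g x - p x‖ ≤ ε :=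
    mem_of_superset ((mem_ae_iff_prob_eq_one hs).2 hm) h
  simpa using norm_integral_le_of_norm_le_const hae

section WeakClosedBall

variable {H : Type*} [NormedAddCommGroup H] [InnerProductSpace ℂ H]

/-- The closed unit ball of a Hilbert space is weakly compact. -/
theorem isCompact_toWeakSpace_symm_preimage_closedBall [CompleteSpace H] :
    IsCompact ((toWeakSpace ℂ H).symm ⁻¹' Metric.closedBall 0 1) := by
  let ψ : WeakDual ℂ H → WeakSpace ℂ H := fun l =>
    toWeakSpace ℂ H ((InnerProductSpace.toDual ℂ H).symm (WeakDual.toStrongDual l))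
  have hψ : Continuous ψ := by
    refine WeakBilin.continuous_of_continuous_eval _ fun m => ?_
    have h : ∀ l, m ((InnerProductSpace.toDual ℂ H).symm (WeakDual.toStrongDual l)) =
        starRingEnd ℂ (l ((InnerProductSpace.toDual ℂ H).symm m)) := fun l => by
      rw [← InnerProductSpace.toDual_symm_apply (x := _) (y := m), ← inner_conj_symm,
        InnerProductSpace.toDual_symm_apply, WeakDual.toStrongDual_apply]
    exact (Complex.continuous_conj.comp
      (WeakDual.eval_continuous ((InnerProductSpace.toDual ℂ H).symm m))).congr fun l => (h l).symm
  convert (WeakDual.isCompact_closedBall (𝕜 := ℂ) (E := H) 0 1).image hψ using 1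
  ext x
  constructor
  · intro hx
    refine ⟨StrongDual.toWeakDual (InnerProductSpace.toDual ℂ H ((toWeakSpace ℂ H).symm x)), ?_, ?_⟩
    · simpa using hx
    · simp [ψ]
  · rintro ⟨l, hl, rfl⟩
    simpa [ψ] using hl

/-- The character `x ↦ exp (-i Re⟪x, y⟫)` as a weakly continuous function. -/
noncomputable def weakCharacter (y : H) : C(WeakSpace ℂ H, ℂ) where
  toFun x := Complex.exp (-Complex.I * ((⟪(toWeakSpace ℂ H).symm x, y⟫_ℂ).re : ℂ))
  continuous_toFun := by
    have h : Continuous fun x : WeakSpace ℂ H => ⟪y, (toWeakSpace ℂ H).symm x⟫_ℂ :=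
      WeakBilin.eval_continuous (topDualPairing ℂ H).flip (innerSL ℂ y)
    simp_rw [← inner_conj_symm _ y, Complex.conj_re]
    fun_prop

theorem weakCharacter_apply (y x : H) : weakCharacter y (toWeakSpace ℂ H x) =
    Complex.exp (-Complex.I * ((⟪x, y⟫_ℂ).re : ℂ)) := rfl

theorem weakCharacter_zero : weakCharacter (0 : H) = 1 := by
  ext x
  simp [weakCharacter]

theorem weakCharacter_add (y z : H) :
    weakCharacter (y + z) = weakCharacter y * weakCharacter z := by
  ext x
  simp [weakCharacter, mul_add, Complex.exp_add]

theorem star_weakCharacter (y : H) : star (weakCharacter y) = weakCharacter (-y) := by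
  ext x
  simp [weakCharacter, ← Complex.exp_conj]

theorem exists_weakCharacter_ne {x x' : WeakSpace ℂ H} (h : x ≠ x') :
    ∃ y : H, weakCharacter y x ≠ weakCharacter y x' := by
  obtain ⟨a, rfl⟩ := (toWeakSpace ℂ H).surjective x
  obtain ⟨b, rfl⟩ := (toWeakSpace ℂ H).surjective x'
  have hd : ‖a - b‖ ^ 2 ≠ 0 := by
    rw [ne_eq, sq_eq_zero_iff, norm_eq_zero, sub_eq_zero]
    exact fun hab => h (by rw [hab])
  refine ⟨((Real.pi / ‖a - b‖ ^ 2 : ℝ) : ℂ) • (a - b), fun hxx => ?_⟩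
  set y := ((Real.pi / ‖a - b‖ ^ 2 : ℝ) : ℂ) • (a - b) with hy
  have hre : (⟪a, y⟫_ℂ).re = Real.pi + (⟪b, y⟫_ℂ).re := by
    have : (⟪a - b, y⟫_ℂ).re = Real.pi := by
      rw [hy, inner_smul_right, Complex.re_ofReal_mul, ← RCLike.re_eq_complex_re,
        inner_self_eq_norm_sq (𝕜 := ℂ) (a - b), div_mul_cancel₀ _ hd]
    rw [← this, inner_sub_left, Complex.sub_re, sub_add_cancel]
  rw [weakCharacter_apply, weakCharacter_apply, hre, Complex.ofReal_add, mul_add, Complex.exp_add,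
    neg_mul, Complex.exp_neg, mul_comm Complex.I, Complex.exp_pi_mul_I] at hxx
  have h0 := Complex.exp_ne_zero (-Complex.I * ((⟪b, y⟫_ℂ).re : ℂ))
  apply h0
  linear_combination (-1 / 2 : ℂ) * hxx

/-- Restriction of the characters to a set `K`, as a monoid homomorphism in the frequency. -/
noncomputable def weakCharacterHom (K : Set (WeakSpace ℂ H)) : Multiplicative H →* C(K, ℂ) where
  toFun y := (weakCharacter y.toAdd).restrict K
  map_one' := by
    ext x
    simp [weakCharacter_zero]
  map_mul' y z := by
    ext x
    simp [weakCharacter_add]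

/-- The star subalgebra generated by the characters on `K`. -/
noncomputable def weakCharacterAlgebra (K : Set (WeakSpace ℂ H)) : StarSubalgebra ℂ C(K, ℂ) where
  toSubalgebra := Algebra.adjoin ℂ (MonoidHom.mrange (weakCharacterHom K) : Set C(K, ℂ))
  star_mem' {g} hg := by
    change star g ∈ Algebra.adjoin ℂ _
    induction hg using Algebra.adjoin_induction with
    | mem g hg =>
      obtain ⟨y, rfl⟩ := hg
      refine Algebra.subset_adjoin ⟨Multiplicative.ofAdd (-y.toAdd), ?_⟩
      ext x
      exact (congrArg (fun u : C(WeakSpace ℂ H, ℂ) => u x) (star_weakCharacter y.toAdd)).symm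
    | algebraMap r =>
      rw [← algebraMap_star_comm]
      exact Subalgebra.algebraMap_mem _ _
    | add g k _ _ hg hk =>
      rw [star_add]
      exact add_mem hg hk
    | mul g k _ _ hg hk =>
      rw [star_mul]
      exact mul_mem hk hg

theorem mem_weakCharacterAlgebra {K : Set (WeakSpace ℂ H)} {g : C(K, ℂ)} :
    g ∈ weakCharacterAlgebra K ↔ g ∈ Submodule.span ℂ (Set.range (weakCharacterHom K)) := by
  change g ∈ Subalgebra.toSubmodule (Algebra.adjoin ℂ _) ↔ _
  rw [Algebra.adjoin_eq_span, Submonoid.closure_eq, MonoidHom.coe_mrange]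

/-- Linear combinations of characters are uniformly dense in the continuous functions on a weakly
compact set. -/
theorem topologicalClosure_weakCharacterAlgebra (K : Set (WeakSpace ℂ H)) [CompactSpace K] :
    (weakCharacterAlgebra K).topologicalClosure = ⊤ := by
  refine ContinuousMap.starSubalgebra_topologicalClosure_eq_top_of_separatesPoints _ ?_
  intro x x' hxx
  obtain ⟨y, hy⟩ := exists_weakCharacter_ne (Subtype.coe_injective.ne hxx)
  exact ⟨_, ⟨weakCharacterHom K (Multiplicative.ofAdd y),
    Algebra.subset_adjoin ⟨_, rfl⟩, rfl⟩, hy⟩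

/-- Continuous functions on the weakly compact set `K` are uniformly approximated by functions in
the span of the characters on the whole space. -/
theorem exists_mem_span_weakCharacter_norm_sub_lt (K : Set (WeakSpace ℂ H)) [CompactSpace K]
    (g : C(K, ℂ)) {ε : ℝ} (hε : 0 < ε) :
    ∃ p ∈ Submodule.span ℂ (Set.range (weakCharacter (H := H))), ∀ x : K, ‖g x - p x‖ < ε := by
  have hg : g ∈ closure (weakCharacterAlgebra K : Set C(K, ℂ)) := by
    rw [← StarSubalgebra.topologicalClosure_coe, topologicalClosure_weakCharacterAlgebra]
    trivial
  obtain ⟨q, hq, hgq⟩ := Metric.mem_closure_iff.1 hg ε hε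
  have hmap : ∃ p ∈ Submodule.span ℂ (Set.range (weakCharacter (H := H))), ∀ x : K, p x = q x := by
    have hq' := mem_weakCharacterAlgebra.1 hq
    clear hgq hq
    induction hq' using Submodule.span_induction with
    | mem q hq =>
      obtain ⟨y, rfl⟩ := hq
      exact ⟨_, Submodule.subset_span ⟨y.toAdd, rfl⟩, fun _ => rfl⟩
    | zero => exact ⟨0, zero_mem _, fun _ => rfl⟩
    | add q r _ _ hq hr =>
      obtain ⟨p, hp, hpq⟩ := hq
      obtain ⟨s, hs, hsr⟩ := hr
      exact ⟨p + s, add_mem hp hs, fun x => by simp [hpq, hsr]⟩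
    | smul c q _ hq =>
      obtain ⟨p, hp, hpq⟩ := hq
      exact ⟨c • p, Submodule.smul_mem _ c hp, fun x => by simp [hpq]⟩
  obtain ⟨p, hp, hpq⟩ := hmap
  refine ⟨p, hp, fun x => ?_⟩
  rw [hpq, ← dist_eq_norm]
  exact (ContinuousMap.dist_apply_le_dist x).trans_lt hgq

variable [MeasurableSpace H] [BorelSpace H]

theorem integrable_of_mem_span_weakCharacter [TopologicalSpace.SeparableSpace H]
    {p : C(WeakSpace ℂ H, ℂ)}
    (hp : p ∈ Submodule.span ℂ (Set.range (weakCharacter (H := H))))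
    (m : Measure H) [IsFiniteMeasure m] : Integrable (fun x => p (toWeakSpace ℂ H x)) m := by
  induction hp using Submodule.span_induction with
  | mem p hp =>
    obtain ⟨y, rfl⟩ := hp
    have : SecondCountableTopology H := UniformSpace.secondCountable_of_separable H
    refine Integrable.of_bound ((weakCharacter y).continuous.comp
      (toWeakSpaceCLM ℂ H).continuous).aestronglyMeasurable 1 (ae_of_all _ fun x => ?_)
    simp [weakCharacter_apply, Complex.norm_exp]
  | zero => exact integrable_zero _ _ _
  | add p q _ _ hp hq => exact hp.add hq
  | smul c p _ hp => exact hp.smul c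

theorem tendsto_integral_of_mem_span_weakCharacter [TopologicalSpace.SeparableSpace H]
    {μ : ℕ → Measure H} {ν : Measure H} [∀ j, IsFiniteMeasure (μ j)] [IsFiniteMeasure ν]
    (hchar : ∀ y : H,
      Tendsto (fun j => ∫ x, Complex.exp (-Complex.I * ((⟪x, y⟫_ℂ).re : ℂ)) ∂(μ j))
        atTop (nhds (∫ x, Complex.exp (-Complex.I * ((⟪x, y⟫_ℂ).re : ℂ)) ∂ν)))
    {p : C(WeakSpace ℂ H, ℂ)}
    (hp : p ∈ Submodule.span ℂ (Set.range (weakCharacter (H := H)))) :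
    Tendsto (fun j => ∫ x, p (toWeakSpace ℂ H x) ∂(μ j)) atTop
      (nhds (∫ x, p (toWeakSpace ℂ H x) ∂ν)) := by
  induction hp using Submodule.span_induction with
  | mem p hp =>
    obtain ⟨y, rfl⟩ := hp
    exact hchar y
  | zero => simp
  | add p q hp hq ihp ihq =>
    have h (m : Measure H) [IsFiniteMeasure m] := integral_add
      (integrable_of_mem_span_weakCharacter hp m) (integrable_of_mem_span_weakCharacter hq m)
    simp only [ContinuousMap.add_apply, h]
    exact ihp.add ihq
  | smul c p _ ihp =>
    simp only [ContinuousMap.smul_apply, integral_smul]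
    exact ihp.const_smul c

end WeakClosedBall

/-- **Convergence of characteristic functions implies weak narrow convergence.**
If `(μ j)` and `ν` are Borel probability measures on a separable complex Hilbert
space `H`, all concentrated on the closed unit ball, and the characteristic
functions `∫ exp(-i Re⟪x,y⟫) dμ j` converge pointwise to those of `ν`, then
`μ j → ν` weakly narrowly, i.e. `∫ f dμ j → ∫ f dν` for every bounded
`f : H → ℝ` which is continuous for the weak topology of `H`. -/
theorem characteristic_functions_convergence_implies_weak_narrow_convergence
    {H : Type*} [NormedAddCommGroup H] [InnerProductSpace ℂ H] [CompleteSpace H]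
    [TopologicalSpace.SeparableSpace H] [MeasurableSpace H] [BorelSpace H]
    (μ : ℕ → Measure H) (ν : Measure H)
    [∀ j, IsProbabilityMeasure (μ j)] [IsProbabilityMeasure ν]
    (hμ : ∀ j, μ j (Metric.closedBall 0 1) = 1)
    (hν : ν (Metric.closedBall 0 1) = 1)
    (hchar : ∀ y : H,
      Tendsto (fun j => ∫ x, Complex.exp (-Complex.I * ((⟪x, y⟫_ℂ).re : ℂ)) ∂(μ j))
        atTop (nhds (∫ x, Complex.exp (-Complex.I * ((⟪x, y⟫_ℂ).re : ℂ)) ∂ν))) :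
    ∀ f : H → ℝ, (∃ C : ℝ, ∀ x, |f x| ≤ C) →
      Continuous (X := WeakSpace ℂ H) f →
      Tendsto (fun j => ∫ x, f x ∂(μ j)) atTop (nhds (∫ x, f x ∂ν)) := by
  rintro f ⟨C, hC⟩ hf
  have hsc : SecondCountableTopology H := UniformSpace.secondCountable_of_separable H
  have hfint (m : Measure H) [IsProbabilityMeasure m] : Integrable (fun x => (f x : ℂ)) m := by
    refine Integrable.ofReal (Integrable.of_bound (C := C) ?_ (ae_of_all _ hC))
    exact (hf.comp (toWeakSpaceCLM ℂ H).continuous).aestronglyMeasurable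
  let K : Set (WeakSpace ℂ H) := (toWeakSpace ℂ H).symm ⁻¹' Metric.closedBall 0 1
  have : CompactSpace K :=
    isCompact_iff_compactSpace.1 isCompact_toWeakSpace_symm_preimage_closedBall
  let g : C(K, ℂ) := ⟨fun x => (f ((toWeakSpace ℂ H).symm x) : ℂ),
    Complex.continuous_ofReal.comp (hf.comp continuous_subtype_val)⟩
  suffices h : Tendsto (fun j => ∫ x, (f x : ℂ) ∂(μ j)) atTop (nhds (∫ x, (f x : ℂ) ∂ν)) by
    simp only [integral_complex_ofReal] at h
    simpa [Function.comp_def] using (Complex.continuous_re.tendsto _).comp h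
  rw [Metric.tendsto_atTop']
  intro ε hε
  obtain ⟨p, hp, hgp⟩ := exists_mem_span_weakCharacter_norm_sub_lt K g (ε := ε / 3) (by positivity)
  have happrox (m : Measure H) [IsProbabilityMeasure m] (hm : m (Metric.closedBall 0 1) = 1) :
      ‖∫ x, (f x : ℂ) ∂m - ∫ x, p (toWeakSpace ℂ H x) ∂m‖ ≤ ε / 3 :=
    norm_integral_sub_integral_le Metric.isClosed_closedBall.measurableSet hm (hfint m)
      (integrable_of_mem_span_weakCharacter hp m)
      fun x hx => (hgp ⟨toWeakSpace ℂ H x, hx⟩).le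
  obtain ⟨N, hN⟩ := Metric.tendsto_atTop'.1
    (tendsto_integral_of_mem_span_weakCharacter hchar hp) (ε / 3) (by positivity)
  refine ⟨N, fun j hj => ?_⟩
  have h₁ := happrox (μ j) (hμ j)
  have h₂ := happrox ν hν
  rw [← dist_eq_norm] at h₁ h₂
  rw [dist_comm] at h₂
  linarith [hN j hj, dist_triangle4 (∫ x, (f x : ℂ) ∂(μ j)) (∫ x, p (toWeakSpace ℂ H x) ∂(μ j))
    (∫ x, p (toWeakSpace ℂ H x) ∂ν) (∫ x, (f x : ℂ) ∂ν)]
end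

section
/- Let H be a separable complex Hilbert space with orthonormal (Hilbert) basis (e_i)_{i∈ℕ}, and let (μ_j)_{j∈ℕ} and μ be Borel probability measures on H, each concentrated on the closed unit ball X₁. Then the following two conditions are equivalent: (a) μ_j converges weakly narrowly to μ and, for every ε > 0, lim_{N→∞} sup_{j∈ℕ} μ_j({x : Σ_{i=N}^∞ |⟨x,e_i⟩|² ≥ ε}) = 0; (b) μ_j converges strongly narrowly to μ, i.e. ∫ f dμ_j → ∫ f dμ for every bounded function f : H → ℝ that is continuous with respect to the norm topology of H. -/
open MeasureTheory Filter
open scoped InnerProductSpace ENNReal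

namespace HilbertBasis

section Algebraic

variable {H : Type*} [NormedAddCommGroup H] [InnerProductSpace ℂ H] (e : HilbertBasis ℕ ℂ H)

/-- The orthogonal projection onto the span of the first `N` vectors of a Hilbert basis. -/
noncomputable def truncate (N : ℕ) : H →L[ℂ] H :=
  ∑ i ∈ Finset.range N, (innerSL ℂ (e i)).smulRight (e i)

theorem truncate_apply (N : ℕ) (x : H) :
    e.truncate N x = ∑ i ∈ Finset.range N, ⟪e i, x⟫_ℂ • e i := by
  simp [truncate]

theorem tendsto_truncate (x : H) :
    Tendsto (fun N => e.truncate N x) atTop (nhds x) := by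
  simpa only [truncate_apply, e.repr_apply_apply] using (e.hasSum_repr x).tendsto_sum_nat

theorem continuous_truncate_weakSpace (N : ℕ) :
    Continuous (X := WeakSpace ℂ H) (e.truncate N) := by
  have hi (i : ℕ) : Continuous (X := WeakSpace ℂ H) (fun x : H => ⟪e i, x⟫_ℂ) :=
    WeakBilin.eval_continuous (topDualPairing ℂ H).flip (innerSL ℂ (e i))
  have : (e.truncate N : H → H) = fun x => ∑ i ∈ Finset.range N, ⟪e i, x⟫_ℂ • e i :=
    funext (e.truncate_apply N)
  rw [this]
  exact continuous_finsetSum _ fun i _ => (hi i).smul continuous_const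

theorem hasSum_norm_inner_sq (x : H) : HasSum (fun i => ‖⟪x, e i⟫_ℂ‖ ^ 2) (‖x‖ ^ 2) := by
  have h := Complex.reCLM.hasSum (e.hasSum_inner_mul_inner x x)
  simp only [inner_self_eq_norm_sq_to_K, ← inner_conj_symm (e _) x] at h
  convert! h using 1
  · ext i
    simp [Complex.mul_conj, Complex.normSq_eq_norm_sq, -Complex.ofReal_pow, -inner_conj_symm]
  · simp [← Complex.ofReal_pow]

theorem inner_sub_truncate (N : ℕ) (x : H) (i : ℕ) :
    ⟪x - e.truncate N x, e i⟫_ℂ = if N ≤ i then ⟪x, e i⟫_ℂ else 0 := by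
  rw [inner_sub_left, truncate_apply, sum_inner]
  simp only [inner_smul_left, inner_conj_symm, orthonormal_iff_ite.mp e.orthonormal, mul_ite,
    mul_one, mul_zero, Finset.sum_ite_eq', Finset.mem_range]
  split_ifs <;> first | omega | simp

theorem hasSum_tail (N : ℕ) (x : H) :
    HasSum (fun i => if N ≤ i then ‖⟪x, e i⟫_ℂ‖ ^ 2 else 0) (‖x - e.truncate N x‖ ^ 2) := by
  convert! e.hasSum_norm_inner_sq (x - e.truncate N x) using 2 with i
  rw [inner_sub_truncate]
  split_ifs <;> simp

theorem antitone_norm_sub_truncate_sq (x : H) :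
    Antitone fun N => ‖x - e.truncate N x‖ ^ 2 := by
  intro M N h
  refine hasSum_le (fun i => ?_) (e.hasSum_tail N x) (e.hasSum_tail M x)
  split_ifs <;> first | omega | positivity | exact le_rfl

/-- The set of points at squared distance at least `ε` from their `N`-th truncation. -/
def tailSet (N : ℕ) (ε : ℝ) : Set H := {x | ε ≤ ‖x - e.truncate N x‖ ^ 2}

theorem setOf_le_tsum_eq_tailSet (N : ℕ) (ε : ℝ) :
    {x : H | ε ≤ ∑' i : ℕ, if N ≤ i then ‖⟪x, (e i : H)⟫_ℂ‖ ^ 2 else 0} = e.tailSet N ε := by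
  simp only [(e.hasSum_tail N _).tsum_eq, tailSet]

theorem isClosed_tailSet (N : ℕ) (ε : ℝ) : IsClosed (e.tailSet N ε) :=
  isClosed_le continuous_const (by fun_prop)

theorem antitone_tailSet (ε : ℝ) : Antitone fun N => e.tailSet N ε :=
  fun _ _ h x hx => le_trans hx (e.antitone_norm_sub_truncate_sq x h)

theorem iInter_tailSet {ε : ℝ} (hε : 0 < ε) : ⋂ N, e.tailSet N ε = ∅ := by
  refine Set.eq_empty_of_forall_notMem fun x hx => ?_
  have h : Tendsto (fun N => ‖x - e.truncate N x‖ ^ 2) atTop (nhds 0) := by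
    simpa using ((tendsto_const_nhds (x := x)).sub (e.tendsto_truncate x)).norm.pow 2
  exact hε.not_ge (ge_of_tendsto' h fun N => Set.mem_iInter.mp hx N)

end Algebraic

variable {H : Type*} [NormedAddCommGroup H] [InnerProductSpace ℂ H]
  [MeasurableSpace H] [BorelSpace H] (e : HilbertBasis ℕ ℂ H)

theorem tendsto_measure_tailSet (ρ : Measure H) [IsFiniteMeasure ρ] {ε : ℝ} (hε : 0 < ε) :
    Tendsto (fun N => ρ (e.tailSet N ε)) atTop (nhds 0) := by
  have h := tendsto_measure_iInter_atTop (μ := ρ)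
    (fun N => (e.isClosed_tailSet N ε).measurableSet.nullMeasurableSet) (e.antitone_tailSet ε)
    ⟨0, measure_ne_top _ _⟩
  rwa [e.iInter_tailSet hε, measure_empty] at h

theorem tendsto_iSup_measure_tailSet {μ : ℕ → ProbabilityMeasure H} {ν : ProbabilityMeasure H}
    (h : Tendsto μ atTop (nhds ν)) {ε : ℝ} (hε : 0 < ε) :
    Tendsto (fun N => ⨆ j, (μ j : Measure H) (e.tailSet N ε)) atTop (nhds 0) := by
  rw [ENNReal.tendsto_nhds_zero]
  intro δ hδ
  obtain ⟨N₀, hN₀⟩ := ((e.tendsto_measure_tailSet (ν : Measure H) hε).eventually_lt_const hδ).exists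
  have hev : ∀ᶠ j in atTop, (μ j : Measure H) (e.tailSet N₀ ε) < δ :=
    eventually_lt_of_limsup_lt
      ((ProbabilityMeasure.limsup_measure_closed_le_of_tendsto h
        (e.isClosed_tailSet N₀ ε)).trans_lt hN₀)
  obtain ⟨J, hJ⟩ := eventually_atTop.mp hev
  have hfin : ∀ᶠ N in atTop, ∀ j ∈ Finset.range J, (μ j : Measure H) (e.tailSet N ε) < δ :=
    (Finset.eventually_all _).mpr fun j _ =>
      (e.tendsto_measure_tailSet (μ j : Measure H) hε).eventually_lt_const hδ
  filter_upwards [hfin, eventually_ge_atTop N₀] with N hN hNN₀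
  refine iSup_le fun j => ?_
  rcases lt_or_ge j J with hj | hj
  · exact (hN j (Finset.mem_range.mpr hj)).le
  · exact (measure_mono (e.antitone_tailSet ε hNN₀)).trans (hJ j hj).le

theorem dist_integral_comp_truncate_le (ρ : Measure H) [IsProbabilityMeasure ρ] {f : H → ℝ}
    {C : ℝ} (hC : ∀ x y, dist (f x) (f y) ≤ C) {L : NNReal} (hL : LipschitzWith L f)
    {s : ℝ} (hs : 0 ≤ s) (N : ℕ) :
    dist (∫ x, f x ∂ρ) (∫ x, f (e.truncate N x) ∂ρ) ≤ L * s + C * ρ.real (e.tailSet N (s ^ 2)) := by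
  have hb (x : H) : ‖f x‖ ≤ ‖f 0‖ + C := by
    have := norm_sub_norm_le (f x) (f 0)
    have := hC x 0
    rw [dist_eq_norm] at this
    linarith
  have hC0 : 0 ≤ C := dist_nonneg.trans (hC 0 0)
  have hf : Integrable f ρ :=
    .of_bound hL.continuous.measurable.aestronglyMeasurable _ (ae_of_all _ hb)
  have hfT : Integrable (fun x => f (e.truncate N x)) ρ :=
    .of_bound (hL.continuous.comp (e.truncate N).continuous).measurable.aestronglyMeasurable _
      (ae_of_all _ fun x => hb _)
  have hA := (e.isClosed_tailSet N (s ^ 2)).measurableSet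
  rw [dist_eq_norm, ← integral_sub hf hfT]
  calc ‖∫ x, f x - f (e.truncate N x) ∂ρ‖
      ≤ ∫ x, L * s + (e.tailSet N (s ^ 2)).indicator (fun _ => C) x ∂ρ := by
        refine norm_integral_le_of_norm_le
          ((integrable_const _).add ((integrable_const C).indicator hA)) (ae_of_all _ fun x => ?_)
        rw [← dist_eq_norm]
        by_cases hx : x ∈ e.tailSet N (s ^ 2)
        · rw [Set.indicator_of_mem hx]
          exact (hC _ _).trans (le_add_of_nonneg_left (by positivity))
        · rw [Set.indicator_of_notMem hx, add_zero]
          refine (hL.dist_le_mul _ _).trans ?_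
          have hlt : ‖x - e.truncate N x‖ ^ 2 < s ^ 2 := not_le.mp hx
          rw [dist_eq_norm]
          exact mul_le_mul_of_nonneg_left (lt_of_pow_lt_pow_left₀ 2 hs hlt).le L.2
    _ = L * s + C * ρ.real (e.tailSet N (s ^ 2)) := by
        rw [integral_add (integrable_const _) ((integrable_const C).indicator hA),
          integral_indicator_const _ hA]
        simp [mul_comm]

theorem tendsto_integral_of_tendsto_integral_truncate {μ : ℕ → Measure H} {ν : Measure H}
    [∀ j, IsProbabilityMeasure (μ j)] [IsProbabilityMeasure ν]
    (htail : ∀ ε : ℝ, 0 < ε → Tendsto (fun N => ⨆ j, μ j (e.tailSet N ε)) atTop (nhds 0))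
    {f : H → ℝ} {C : ℝ} (hC : ∀ x y, dist (f x) (f y) ≤ C) {L : NNReal} (hL : LipschitzWith L f)
    (h : ∀ N, Tendsto (fun j => ∫ x, f (e.truncate N x) ∂μ j) atTop
      (nhds (∫ x, f (e.truncate N x) ∂ν))) :
    Tendsto (fun j => ∫ x, f x ∂μ j) atTop (nhds (∫ x, f x ∂ν)) := by
  have hC0 : 0 ≤ C := dist_nonneg.trans (hC 0 0)
  rw [Metric.tendsto_atTop']
  intro δ hδ
  obtain ⟨s, hs, hLs⟩ : ∃ s : ℝ, 0 < s ∧ L * s < δ / 6 := by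
    refine ⟨δ / 6 / (L + 1), by positivity, ?_⟩
    rw [← mul_div_assoc, div_lt_iff₀ (by positivity)]
    nlinarith [L.2]
  obtain ⟨η, hη, hCη⟩ : ∃ η : ℝ, 0 < η ∧ C * η < δ / 6 := by
    refine ⟨δ / 6 / (C + 1), by positivity, ?_⟩
    rw [← mul_div_assoc, div_lt_iff₀ (by positivity)]
    nlinarith
  have hη' : 0 < ENNReal.ofReal η := ENNReal.ofReal_pos.mpr hη
  obtain ⟨N, hμN, hνN⟩ := (((htail _ (pow_pos hs 2)).eventually_lt_const hη').and
    ((e.tendsto_measure_tailSet ν (pow_pos hs 2)).eventually_lt_const hη')).exists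
  have key (ρ : Measure H) [IsProbabilityMeasure ρ]
      (hρ : ρ (e.tailSet N (s ^ 2)) ≤ ENNReal.ofReal η) :
      dist (∫ x, f x ∂ρ) (∫ x, f (e.truncate N x) ∂ρ) < δ / 3 := by
    have h₁ := e.dist_integral_comp_truncate_le ρ hC hL hs.le N
    have h₂ := mul_le_mul_of_nonneg_left (ENNReal.toReal_le_of_le_ofReal hη.le hρ) hC0
    rw [Measure.real] at h₁
    linarith
  obtain ⟨J, hJ⟩ := Metric.tendsto_atTop'.mp (h N) (δ / 3) (by positivity)
  refine ⟨J, fun j hj => ?_⟩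
  have h₁ := key (μ j) ((le_iSup (fun j => μ j (e.tailSet N (s ^ 2))) j).trans hμN.le)
  have h₂ := key ν hνN.le
  have h₃ := dist_triangle4_right (∫ x, f x ∂μ j) (∫ x, f x ∂ν)
    (∫ x, f (e.truncate N x) ∂μ j) (∫ x, f (e.truncate N x) ∂ν)
  linarith [hJ j hj]

end HilbertBasis

/-- Convergence of probability measures tested against bounded continuous functions, with
boundedness stated as an explicit hypothesis. -/
theorem MeasureTheory.ProbabilityMeasure.tendsto_iff_forall_bounded_continuous
    {X γ : Type*} [TopologicalSpace X] [MeasurableSpace X] [OpensMeasurableSpace X]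
    {F : Filter γ} {μ : γ → ProbabilityMeasure X} {ν : ProbabilityMeasure X} :
    Tendsto μ F (nhds ν) ↔ ∀ f : X → ℝ, (∃ C : ℝ, ∀ x, |f x| ≤ C) → Continuous f →
      Tendsto (fun j => ∫ x, f x ∂(μ j : Measure X)) F (nhds (∫ x, f x ∂(ν : Measure X))) := by
  rw [ProbabilityMeasure.tendsto_iff_forall_integral_tendsto]
  refine ⟨fun h f ⟨C, hC⟩ hf => h (.ofNormedAddCommGroup f hf C hC), fun h f => ?_⟩
  exact h f ⟨‖f‖, f.norm_coe_le_norm⟩ f.continuous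

/-- **Weak vs strong narrow convergence of probability measures on a Hilbert ball.**
Let `(μ j)` and `ν` be Borel probability measures on a separable complex Hilbert
space `H`, concentrated on the closed unit ball, and let `e` be an orthonormal
(Hilbert) basis of `H`. Then `μ j → ν` weakly narrowly together with the uniform
tail condition `lim_{N→∞} sup_j μ j {x : ∑_{i ≥ N} |⟨x,e_i⟩|² ≥ ε} = 0` for every
`ε > 0` if and only if `μ j → ν` strongly narrowly (i.e. `∫ f dμ j → ∫ f dν` for
every bounded norm-continuous `f : H → ℝ`). -/
theorem weak_narrow_plus_tail_iff_strong_narrow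
    {H : Type*} [NormedAddCommGroup H] [InnerProductSpace ℂ H] [CompleteSpace H]
    [TopologicalSpace.SeparableSpace H] [MeasurableSpace H] [BorelSpace H]
    (e : HilbertBasis ℕ ℂ H)
    (μ : ℕ → Measure H) (ν : Measure H)
    [∀ j, IsProbabilityMeasure (μ j)] [IsProbabilityMeasure ν]
    (hμ : ∀ j, μ j (Metric.closedBall 0 1) = 1)
    (hν : ν (Metric.closedBall 0 1) = 1) :
    ((∀ f : H → ℝ, (∃ C : ℝ, ∀ x, |f x| ≤ C) →
        Continuous (X := WeakSpace ℂ H) f →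
        Tendsto (fun j => ∫ x, f x ∂(μ j)) atTop (nhds (∫ x, f x ∂ν))) ∧
      (∀ ε : ℝ, 0 < ε →
        Tendsto
          (fun N : ℕ =>
            ⨆ j : ℕ, μ j {x : H | ε ≤ ∑' i : ℕ, if N ≤ i then ‖⟪x, (e i : H)⟫_ℂ‖ ^ 2 else 0})
          atTop (nhds (0 : ℝ≥0∞))))
    ↔ (∀ f : H → ℝ, (∃ C : ℝ, ∀ x, |f x| ≤ C) → Continuous f →
        Tendsto (fun j => ∫ x, f x ∂(μ j)) atTop (nhds (∫ x, f x ∂ν))) := by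
  let μ' : ℕ → ProbabilityMeasure H := fun j => ⟨μ j, inferInstance⟩
  let ν' : ProbabilityMeasure H := ⟨ν, inferInstance⟩
  have hiff := ProbabilityMeasure.tendsto_iff_forall_bounded_continuous
    (F := atTop) (μ := μ') (ν := ν')
  simp only [e.setOf_le_tsum_eq_tailSet]
  constructor
  · rintro ⟨hweak, htail⟩
    refine hiff.mp (tendsto_iff_forall_lipschitz_integral_tendsto.mpr ?_)
    rintro f ⟨C, hC⟩ ⟨L, hL⟩
    refine e.tendsto_integral_of_tendsto_integral_truncate htail hC hL fun N => ?_
    refine hweak _ ⟨|f 0| + C, fun x => ?_⟩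
      (hL.continuous.comp (e.continuous_truncate_weakSpace N))
    have h₁ := abs_sub_abs_le_abs_sub (f (e.truncate N x)) (f 0)
    have h₂ := hC (e.truncate N x) 0
    rw [Real.dist_eq] at h₂
    linarith
  · intro hstrong
    refine ⟨fun f hb hf => hstrong f hb ?_, fun ε hε => ?_⟩
    · exact Continuous.comp (Y := WeakSpace ℂ H) hf (toWeakSpaceCLM ℂ H).continuous
    · exact e.tendsto_iSup_measure_tailSet (hiff.mpr hstrong) hε
end

section
/- Let H be a separable complex Hilbert space with orthonormal basis (e_n)_{n∈ℕ}, and let X₁ be its closed unit ball. For each n ∈ ℕ define Ψ_n : X₁ → H by Ψ_n(φ) = φ + (√(1 − ‖φ‖² + |⟨e_n,φ⟩|²) − ⟨e_n,φ⟩)·e_n (note that 1 − ‖φ‖² + |⟨e_n,φ⟩|² = 1 − Σ_{k≠n}|⟨e_k,φ⟩|² ≥ 0 by Parseval's identity, so the square root is well defined). Then: (a) ‖Ψ_n(φ)‖ = 1 for every φ ∈ X₁; (b) each Ψ_n is continuous from X₁ (with the norm topology) to H; (c) for every φ ∈ X₁, Ψ_n(φ) converges weakly to φ as n → ∞, i.e.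 ⟨y, Ψ_n(φ)⟩ → ⟨y, φ⟩ for every y ∈ H. -/
open MeasureTheory Filter
open scoped InnerProductSpace

/-- Replacing the component of `x` along a unit vector `u` by `c` changes the squared norm by
`‖c‖ ^ 2 - ‖⟪u, x⟫‖ ^ 2`. -/
theorem norm_add_sub_inner_smul_sq {E : Type*} [NormedAddCommGroup E] [InnerProductSpace ℂ E]
    {u : E} (hu : ‖u‖ = 1) (x : E) (c : ℂ) :
    ‖x + (c - ⟪u, x⟫_ℂ) • u‖ ^ 2 = ‖x‖ ^ 2 - ‖⟪u, x⟫_ℂ‖ ^ 2 + ‖c‖ ^ 2 := by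
  set w := x - ⟪u, x⟫_ℂ • u with hw
  have hwu : ⟪u, w⟫_ℂ = 0 := by
    simp [hw, inner_self_eq_norm_sq_to_K, hu]
  have pythagoras (d : ℂ) : ‖w + d • u‖ ^ 2 = ‖w‖ ^ 2 + ‖d‖ ^ 2 := by
    have h := norm_add_sq_eq_norm_sq_add_norm_sq_of_inner_eq_zero w (d • u)
      (by rw [inner_smul_right, inner_eq_zero_symm.mp hwu, mul_zero])
    simpa [norm_smul, hu, ← sq] using h
  have hx : x = w + ⟪u, x⟫_ℂ • u := by simp [hw]
  have hc : x + (c - ⟪u, x⟫_ℂ) • u = w + c • u := by rw [hw, sub_smul]; abel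
  have h := pythagoras ⟪u, x⟫_ℂ
  rw [← hx] at h
  rw [hc, pythagoras, h]
  ring

/-- The coordinates of a vector in an orthonormal sequence tend to zero. -/
theorem Orthonormal.tendsto_inner_zero {E : Type*} [NormedAddCommGroup E] [InnerProductSpace ℂ E]
    {e : ℕ → E} (he : Orthonormal ℂ e) (x : E) :
    Tendsto (fun n => ⟪e n, x⟫_ℂ) atTop (nhds 0) := by
  have h := (he.inner_products_summable (x := x)).tendsto_atTop_zero.sqrt
  rw [tendsto_zero_iff_norm_tendsto_zero]
  simpa [Real.sqrt_sq] using h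

/-- **The sphere-valued approximation maps `Ψ_n`.**
Let `(e n)` be an orthonormal basis of the separable complex Hilbert space `H`
and, for `φ` in the closed unit ball, set
`Ψ n φ = φ + (√(1 - ‖φ‖² + |⟨e n, φ⟩|²) - ⟨e n, φ⟩) • e n`.
Then (a) `‖Ψ n φ‖ = 1` on the ball, (b) each `Ψ n` is norm-continuous on the
ball, (c) `Ψ n φ ⇀ φ` weakly as `n → ∞` for every `φ` in the ball. -/
theorem sphere_approximation_maps
    {H : Type*} [NormedAddCommGroup H] [InnerProductSpace ℂ H] [CompleteSpace H]
    [TopologicalSpace.SeparableSpace H]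
    (e : HilbertBasis ℕ ℂ H)
    (Ψ : ℕ → H → H)
    (hΨ : ∀ n : ℕ, ∀ φ : H,
      Ψ n φ = φ +
        ((Real.sqrt (1 - ‖φ‖ ^ 2 + ‖⟪(e n : H), φ⟫_ℂ‖ ^ 2) : ℂ) - ⟪(e n : H), φ⟫_ℂ) • (e n : H)) :
    (∀ n : ℕ, ∀ φ ∈ Metric.closedBall (0 : H) 1, ‖Ψ n φ‖ = 1) ∧
    (∀ n : ℕ, ContinuousOn (Ψ n) (Metric.closedBall (0 : H) 1)) ∧
    (∀ φ ∈ Metric.closedBall (0 : H) 1, ∀ y : H,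
      Tendsto (fun n : ℕ => ⟪y, Ψ n φ⟫_ℂ) atTop (nhds ⟪y, φ⟫_ℂ)) := by
  have hnorm (n : ℕ) : ‖e n‖ = 1 := e.orthonormal.norm_eq_one n
  refine ⟨fun n φ hφ => ?_, fun n => ?_, fun φ _ y => ?_⟩
  · have hφ1 : ‖φ‖ ^ 2 ≤ 1 := pow_le_one₀ (norm_nonneg φ) (mem_closedBall_zero_iff.mp hφ)
    have hnonneg : 0 ≤ 1 - ‖φ‖ ^ 2 + ‖⟪e n, φ⟫_ℂ‖ ^ 2 := by
      linarith [sq_nonneg ‖⟪e n, φ⟫_ℂ‖]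
    have h := norm_add_sub_inner_smul_sq (hnorm n) φ
      (Real.sqrt (1 - ‖φ‖ ^ 2 + ‖⟪e n, φ⟫_ℂ‖ ^ 2) : ℂ)
    rw [← hΨ, Complex.norm_real, Real.norm_eq_abs, sq_abs, Real.sq_sqrt hnonneg] at h
    rw [← sq_eq_sq₀ (norm_nonneg _) zero_le_one]
    linarith
  · rw [funext (hΨ n)]
    fun_prop
  · have hφ := e.orthonormal.tendsto_inner_zero φ
    have hy : Tendsto (fun n => ⟪y, e n⟫_ℂ) atTop (nhds 0) := by
      simpa [Function.comp_def] using
        (Complex.continuous_conj.tendsto 0).comp (e.orthonormal.tendsto_inner_zero y)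
    have hsqrt : Tendsto
        (fun n => (Real.sqrt (1 - ‖φ‖ ^ 2 + ‖⟪e n, φ⟫_ℂ‖ ^ 2) : ℂ)) atTop
        (nhds (Real.sqrt (1 - ‖φ‖ ^ 2 + ‖(0 : ℂ)‖ ^ 2) : ℂ)) :=
      (Complex.continuous_ofReal.tendsto _).comp ((hφ.norm.pow 2).const_add _).sqrt
    have h := ((hsqrt.sub hφ).mul hy).const_add ⟪y, φ⟫_ℂ
    simpa only [hΨ, inner_add_right, inner_smul_right, mul_zero, add_zero] using h
end

section
/- Let H be a separable complex Hilbert space and let μ be a U(1)-invariant Borel probability measure on H concentrated on the closed unit ball X₁. Then for every y ∈ H and every k ∈ ℕ: ∫ (Re⟨y,x⟩)^{2k+1} dμ(x) = 0 and ∫ (Re⟨y,x⟩)^{2k} dμ(x) = 4^{−k} · C(2k,k) · ∫ |⟨y,x⟩|^{2k} dμ(x), where C(2k,k) is the binomial coefficient (2k choose k). -/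
open MeasureTheory
open scoped InnerProductSpace

/-- The even moments of the cosine over a full period. -/
lemma integral_cos_pow_two_mul_period (k : ℕ) :
    ∫ t in (0 : ℝ)..2 * Real.pi, Real.cos t ^ (2 * k)
      = 2 * Real.pi * ((4 : ℝ)⁻¹ ^ k * (Nat.choose (2 * k) k : ℝ)) := by
  induction k with
  | zero => simp
  | succ k ih =>
    have hc : ((k : ℝ) + 1) * (Nat.choose (2 * (k + 1)) (k + 1) : ℝ)
        = 2 * (2 * k + 1) * (Nat.choose (2 * k) k : ℝ) := by
      exact_mod_cast Nat.succ_mul_centralBinom_succ k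
    have hk : (k : ℝ) + 1 ≠ 0 := by positivity
    rw [show 2 * (k + 1) = 2 * k + 2 by ring] at hc ⊢
    rw [integral_cos_pow, ih, eq_div_of_mul_eq hk ((mul_comm _ _).trans hc)]
    simp only [Real.sin_two_pi, Real.sin_zero, pow_succ]
    push_cast
    field_simp
    ring

/-- The even moments of the real part of a complex number rotated over the circle. -/
lemma integral_re_exp_mul_pow_two_mul (z : ℂ) (k : ℕ) :
    ∫ t in (0 : ℝ)..2 * Real.pi, (Complex.exp (t * Complex.I) * z).re ^ (2 * k)
      = 2 * Real.pi * ((4 : ℝ)⁻¹ ^ k * (Nat.choose (2 * k) k : ℝ)) * ‖z‖ ^ (2 * k) := by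
  have hre (t : ℝ) : (Complex.exp (t * Complex.I) * z).re ^ (2 * k)
      = Real.cos (t + z.arg) ^ (2 * k) * ‖z‖ ^ (2 * k) := by
    rw [← mul_pow, Complex.mul_re, Complex.exp_ofReal_mul_I_re, Complex.exp_ofReal_mul_I_im,
      Real.cos_add]
    congr 1
    linear_combination -Real.cos t * Complex.norm_mul_cos_arg z
      + Real.sin t * Complex.norm_mul_sin_arg z
  have hper : Function.Periodic (fun t : ℝ => Real.cos t ^ (2 * k)) (2 * Real.pi) :=
    fun t => by simp only [Real.cos_add_two_pi]
  simp only [hre]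
  rw [intervalIntegral.integral_mul_const,
    intervalIntegral.integral_comp_add_right (fun t => Real.cos t ^ (2 * k)), zero_add,
    add_comm (2 * Real.pi), hper.intervalIntegral_add_eq z.arg 0, zero_add,
    integral_cos_pow_two_mul_period]

/-- **Moments of `Re⟨y,x⟩` for a `U(1)`-invariant measure.**
If `μ` is a `U(1)`-invariant Borel probability measure on a separable complex
Hilbert space, concentrated on the closed unit ball, then for every `y` and
every `k`: odd moments of `Re⟨y,x⟩` vanish and
`∫ (Re⟨y,x⟩)^(2k) dμ = 4⁻ᵏ (2k choose k) ∫ |⟨y,x⟩|^(2k) dμ`. -/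
theorem U1_invariant_real_part_moments
    {H : Type*} [NormedAddCommGroup H] [InnerProductSpace ℂ H] [CompleteSpace H]
    [TopologicalSpace.SeparableSpace H] [MeasurableSpace H] [BorelSpace H]
    (μ : Measure H) [IsProbabilityMeasure μ]
    (hball : μ (Metric.closedBall 0 1) = 1)
    (hinv : ∀ θ : ℝ, Measure.map (fun x : H => Complex.exp (θ * Complex.I) • x) μ = μ) :
    ∀ y : H, ∀ k : ℕ,
      (∫ x, ((⟪y, x⟫_ℂ).re) ^ (2 * k + 1) ∂μ = 0) ∧
      (∫ x, ((⟪y, x⟫_ℂ).re) ^ (2 * k) ∂μ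
        = ((4 : ℝ)⁻¹ ^ k * (Nat.choose (2 * k) k : ℝ)) * ∫ x, ‖⟪y, x⟫_ℂ‖ ^ (2 * k) ∂μ) := by
  intro y k
  have : SecondCountableTopology H := UniformSpace.secondCountable_of_separable H
  have hrot (n : ℕ) (θ : ℝ) : ∫ x, (Complex.exp (θ * Complex.I) * ⟪y, x⟫_ℂ).re ^ n ∂μ
      = ∫ x, (⟪y, x⟫_ℂ).re ^ n ∂μ := by
    conv_rhs => rw [← hinv θ]
    rw [integral_map (by fun_prop)
      (Continuous.aestronglyMeasurable (by fun_prop))]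
    simp only [inner_smul_right]
  refine ⟨?_, ?_⟩
  · have h := hrot (2 * k + 1) Real.pi
    simp only [Complex.exp_pi_mul_I, neg_mul, one_mul, Complex.neg_re,
      Odd.neg_pow (odd_two_mul_add_one k), integral_neg] at h
    linarith
  · have hae : ∀ᵐ x ∂μ, ‖x‖ ≤ 1 := by
      have h : ∀ᵐ x ∂μ, x ∈ Metric.closedBall (0 : H) 1 :=
        (mem_ae_iff_prob_eq_one Metric.isClosed_closedBall.measurableSet).2 hball
      simpa using h
    have hint : Integrable (Function.uncurry fun (t : ℝ) (x : H) =>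
        (Complex.exp (t * Complex.I) * ⟪y, x⟫_ℂ).re ^ (2 * k))
        ((volume.restrict (Set.Ioc 0 (2 * Real.pi))).prod μ) := by
      refine Integrable.of_bound (C := ‖y‖ ^ (2 * k))
        (Continuous.aestronglyMeasurable (by fun_prop)) ?_
      filter_upwards [Measure.quasiMeasurePreserving_snd.ae hae] with p hp
      rw [Function.uncurry_def, norm_pow]
      refine pow_le_pow_left₀ (norm_nonneg _) ?_ _
      calc _ ≤ ‖Complex.exp (p.1 * Complex.I) * ⟪y, p.2⟫_ℂ‖ := Complex.abs_re_le_norm _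
        _ = ‖⟪y, p.2⟫_ℂ‖ := by rw [norm_mul, Complex.norm_exp_ofReal_mul_I, one_mul]
        _ ≤ ‖y‖ * ‖p.2‖ := norm_inner_le_norm _ _
        _ ≤ ‖y‖ := mul_le_of_le_one_right (norm_nonneg _) hp
    have h := integral_integral_swap hint
    simp only [hrot, ← intervalIntegral.integral_of_le Real.two_pi_pos.le,
      integral_re_exp_mul_pow_two_mul, intervalIntegral.integral_const, sub_zero, smul_eq_mul,
      integral_const_mul] at h
    exact mul_left_cancel₀ Real.two_pi_pos.ne' (h.trans (mul_assoc _ _ _))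
end

section
/- Let H be a separable complex Hilbert space and let μ be a U(1)-invariant Borel probability measure on H concentrated on the closed unit ball X₁. Then for every y ∈ H, the characteristic function of μ has the absolutely convergent expansion ∫ e^{2πi·Re⟨y,x⟩} dμ(x) = Σ_{k=0}^∞ (−1)^k · π^{2k}/(k!)² · ∫ |⟨y,x⟩|^{2k} dμ(x). -/
open MeasureTheory Real
open scoped InnerProductSpace

open scoped ComplexConjugate

/-- The double power series of `exp (2 π i Re w) = exp (π i w) * exp (π i (conj w))`. -/
lemma hasSum_exp_two_pi_I_re (w : ℂ) :
    HasSum (fun p : ℕ × ℕ => (π * Complex.I) ^ (p.1 + p.2) / (p.1.factorial * p.2.factorial)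
        * (w ^ p.1 * conj w ^ p.2))
      (Complex.exp (2 * π * Complex.I * (w.re : ℂ))) := by
  have hexp (z : ℂ) : HasSum (fun n : ℕ => z ^ n / n.factorial) (Complex.exp z) := by
    rw [Complex.exp_eq_exp_ℂ]
    exact NormedSpace.expSeries_div_hasSum_exp z
  have hnorm (z : ℂ) : Summable fun n : ℕ => ‖z ^ n / n.factorial‖ := by
    simpa [norm_div, norm_pow] using Real.summable_pow_div_factorial ‖z‖
  have hmul := (hexp (π * Complex.I * w)).mul (hexp (π * Complex.I * conj w))
    (summable_mul_of_summable_norm (f := fun n : ℕ => (π * Complex.I * w) ^ n / n.factorial)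
      (g := fun n : ℕ => (π * Complex.I * conj w) ^ n / n.factorial) (hnorm _) (hnorm _))
  rw [← Complex.exp_add] at hmul
  have hsum : π * Complex.I * w + π * Complex.I * conj w
      = 2 * π * Complex.I * (w.re : ℂ) := by
    rw [← mul_add, Complex.add_conj]
    push_cast
    ring
  rw [hsum] at hmul
  refine hmul.congr_fun fun p => ?_
  rw [mul_pow _ w, mul_pow _ (conj w), pow_add, div_mul_div_comm, mul_mul_mul_comm,
    div_mul_eq_mul_div]

section UnitaryInvariance

variable {H : Type*} [NormedAddCommGroup H] [InnerProductSpace ℂ H] [MeasurableSpace H]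
  [BorelSpace H]

/-- Off-diagonal mixed moments of a `U(1)`-invariant measure vanish. -/
lemma integral_inner_pow_mul_conj_pow_eq_zero (μ : Measure H)
    [SecondCountableTopology H]
    (hinv : ∀ θ : ℝ, Measure.map (fun x : H => Complex.exp (θ * Complex.I) • x) μ = μ)
    (y : H) {a b : ℕ} (hab : a ≠ b) :
    ∫ x, ⟪y, x⟫_ℂ ^ a * conj ⟪y, x⟫_ℂ ^ b ∂μ = 0 := by
  have hab' : (a : ℂ) - b ≠ 0 := sub_ne_zero.2 (by exact_mod_cast hab)
  set θ : ℝ := π / (a - b)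
  have hphase : Complex.exp (θ * Complex.I) ^ a * conj (Complex.exp (θ * Complex.I)) ^ b = -1 := by
    rw [← Complex.exp_conj, ← Complex.exp_nat_mul, ← Complex.exp_nat_mul, ← Complex.exp_add,
      ← Complex.exp_pi_mul_I]
    congr 1
    simp only [map_mul, Complex.conj_ofReal, Complex.conj_I, θ]
    push_cast
    field_simp
    ring
  have hcont : Continuous fun x : H => ⟪y, x⟫_ℂ ^ a * conj ⟪y, x⟫_ℂ ^ b := by fun_prop
  have hneg : ∫ x, ⟪y, x⟫_ℂ ^ a * conj ⟪y, x⟫_ℂ ^ b ∂μ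
      = -∫ x, ⟪y, x⟫_ℂ ^ a * conj ⟪y, x⟫_ℂ ^ b ∂μ := by
    conv_lhs => rw [← hinv θ]
    rw [integral_map (by fun_prop) hcont.aestronglyMeasurable, ← integral_neg]
    congr 1 with x
    rw [inner_smul_right, map_mul, mul_pow, mul_pow, mul_mul_mul_comm, hphase, neg_one_mul]
  exact self_eq_neg.1 hneg

/-- The characteristic function of a `U(1)`-invariant probability measure on the unit ball is
the sum of its diagonal moments. -/
lemma hasSum_integral_exp_two_pi_I_re_inner (μ : Measure H) [IsProbabilityMeasure μ]
    [SecondCountableTopology H]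
    (hball : μ (Metric.closedBall 0 1) = 1)
    (hinv : ∀ θ : ℝ, Measure.map (fun x : H => Complex.exp (θ * Complex.I) • x) μ = μ) (y : H) :
    HasSum (fun k : ℕ => (((-1 : ℝ) ^ k * π ^ (2 * k) / (k.factorial : ℝ) ^ 2
        * ∫ x, ‖⟪y, x⟫_ℂ‖ ^ (2 * k) ∂μ : ℝ) : ℂ))
      (∫ x, Complex.exp (2 * π * Complex.I * ((⟪y, x⟫_ℂ).re : ℂ)) ∂μ) := by
  let F : ℕ × ℕ → H → ℂ := fun p x =>
    (π * Complex.I) ^ (p.1 + p.2) / (p.1.factorial * p.2.factorial)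
      * (⟪y, x⟫_ℂ ^ p.1 * conj ⟪y, x⟫_ℂ ^ p.2)
  let B : ℕ × ℕ → ℝ := fun p =>
    (π * ‖y‖) ^ p.1 / p.1.factorial * ((π * ‖y‖) ^ p.2 / p.2.factorial)
  have hae : ∀ᵐ x ∂μ, ‖⟪y, x⟫_ℂ‖ ≤ ‖y‖ := by
    have hmem : ∀ᵐ x ∂μ, x ∈ Metric.closedBall (0 : H) 1 :=
      (prob_compl_eq_zero_iff Metric.isClosed_closedBall.measurableSet).2 hball
    filter_upwards [hmem] with x hx
    exact (norm_inner_le_norm y x).trans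
      (mul_le_of_le_one_right (norm_nonneg y) (mem_closedBall_zero_iff.1 hx))
  have hFB (p : ℕ × ℕ) : ∀ᵐ x ∂μ, ‖F p x‖ ≤ B p := by
    filter_upwards [hae] with x hx
    have hnorm : ‖F p x‖ = (π * ‖⟪y, x⟫_ℂ‖) ^ p.1 / p.1.factorial
        * ((π * ‖⟪y, x⟫_ℂ‖) ^ p.2 / p.2.factorial) := by
      simp only [F, norm_mul, norm_div, norm_pow, RCLike.norm_conj, Complex.norm_I,
        Complex.norm_natCast, Complex.norm_real, Real.norm_eq_abs, abs_of_pos pi_pos]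
      ring
    rw [hnorm]
    simp only [B]
    gcongr
  have hB : Summable B :=
    (Real.summable_pow_div_factorial _).mul_of_nonneg (Real.summable_pow_div_factorial _)
      (fun _ => by positivity) (fun _ => by positivity)
  have hFint (p : ℕ × ℕ) : Integrable (F p) μ :=
    Integrable.of_bound (by fun_prop) (B p) (hFB p)
  have hsum : HasSum (fun p => ∫ x, F p x ∂μ)
      (∫ x, Complex.exp (2 * π * Complex.I * ((⟪y, x⟫_ℂ).re : ℂ)) ∂μ) :=
    hasSum_integral_of_dominated_convergence (fun p _ => B p)
      (fun p => (hFint p).aestronglyMeasurable) hFB (.of_forall fun _ => hB)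
      (integrable_const _) (.of_forall fun x => hasSum_exp_two_pi_I_re ⟪y, x⟫_ℂ)
  have hdiag : Function.Injective fun k : ℕ => (k, k) := fun _ _ h => (Prod.ext_iff.1 h).1
  rw [← hdiag.hasSum_iff] at hsum
  · refine hsum.congr_fun fun k => ?_
    have hpow (x : H) : ⟪y, x⟫_ℂ ^ k * conj ⟪y, x⟫_ℂ ^ k = ((‖⟪y, x⟫_ℂ‖ ^ (2 * k) : ℝ) : ℂ) := by
      rw [← mul_pow, Complex.mul_conj', pow_mul]
      push_cast
      rfl
    simp only [Function.comp_apply, F, hpow]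
    rw [integral_const_mul, integral_complex_ofReal, ← two_mul, mul_pow, pow_mul Complex.I,
      Complex.I_sq]
    push_cast
    ring
  · rintro ⟨a, b⟩ hp
    have hab : a ≠ b := fun h => hp ⟨a, by rw [h]⟩
    simp only [F]
    rw [integral_const_mul, integral_inner_pow_mul_conj_pow_eq_zero μ hinv y hab, mul_zero]

end UnitaryInvariance

/-- **Series expansion of the characteristic function of a `U(1)`-invariant measure.**
If `μ` is a `U(1)`-invariant Borel probability measure on a separable complex
Hilbert space, concentrated on the closed unit ball, then for every `y`:
the series `∑ₖ (-1)^k π^(2k)/(k!)² ∫ |⟨y,x⟩|^(2k) dμ` converges absolutely and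
`∫ e^{2πi Re⟨y,x⟩} dμ = ∑ₖ (-1)^k π^(2k)/(k!)² ∫ |⟨y,x⟩|^(2k) dμ`. -/
theorem U1_invariant_characteristic_function_expansion
    {H : Type*} [NormedAddCommGroup H] [InnerProductSpace ℂ H] [CompleteSpace H]
    [TopologicalSpace.SeparableSpace H] [MeasurableSpace H] [BorelSpace H]
    (μ : Measure H) [IsProbabilityMeasure μ]
    (hball : μ (Metric.closedBall 0 1) = 1)
    (hinv : ∀ θ : ℝ, Measure.map (fun x : H => Complex.exp (θ * Complex.I) • x) μ = μ) :
    ∀ y : H,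
      Summable (fun k : ℕ =>
        |(-1 : ℝ) ^ k * π ^ (2 * k) / ((Nat.factorial k : ℝ)) ^ 2
          * ∫ x, ‖⟪y, x⟫_ℂ‖ ^ (2 * k) ∂μ|) ∧
      (∫ x, Complex.exp (2 * π * Complex.I * ((⟪y, x⟫_ℂ).re : ℂ)) ∂μ)
        = ((∑' k : ℕ, (-1 : ℝ) ^ k * π ^ (2 * k) / ((Nat.factorial k : ℝ)) ^ 2
            * ∫ x, ‖⟪y, x⟫_ℂ‖ ^ (2 * k) ∂μ : ℝ) : ℂ) := by
  intro y
  have : SecondCountableTopology H := UniformSpace.secondCountable_of_separable H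
  have hsum := hasSum_integral_exp_two_pi_I_re_inner μ hball hinv y
  refine ⟨(Complex.summable_ofReal.1 hsum.summable).abs, ?_⟩
  rw [Complex.ofReal_tsum]
  exact hsum.tsum_eq.symm
end

section
/- Let H be a separable complex Hilbert space and let (μ_j)_{j∈ℕ} and μ be U(1)-invariant Borel probability measures on H, each concentrated on the closed unit ball X₁. Then μ_j converges weakly narrowly to μ if and only if for every ξ ∈ H and every k ∈ ℕ, ∫ |⟨x,ξ⟩|^{2k} dμ_j(x) → ∫ |⟨x,ξ⟩|^{2k} dμ(x) as j → ∞. -/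
open MeasureTheory Filter
open scoped InnerProductSpace

/-- The closed unit ball of a Hilbert space is weakly compact. -/
theorem isCompact_toWeakSpace_image_closedBall (H : Type*) [NormedAddCommGroup H]
    [InnerProductSpace ℂ H] [CompleteSpace H] :
    IsCompact (toWeakSpace ℂ H '' Metric.closedBall 0 1) := by
  let g : WeakDual ℂ H → WeakSpace ℂ H := fun ℓ =>
    toWeakSpace ℂ H ((InnerProductSpace.toDual ℂ H).symm (WeakDual.toStrongDual ℓ))
  have hg : Continuous g := by
    refine WeakBilin.continuous_of_continuous_eval _ fun φ => ?_
    have h (ℓ : WeakDual ℂ H) :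
        φ ((InnerProductSpace.toDual ℂ H).symm (WeakDual.toStrongDual ℓ)) =
          starRingEnd ℂ (ℓ ((InnerProductSpace.toDual ℂ H).symm φ)) := by
      rw [← InnerProductSpace.toDual_symm_apply (y := φ), ← inner_conj_symm,
        InnerProductSpace.toDual_symm_apply]
      rfl
    exact (Complex.continuous_conj.comp (WeakDual.eval_continuous _)).congr fun ℓ => (h ℓ).symm
  convert (WeakDual.isCompact_closedBall (𝕜 := ℂ) (E := H) 0 1).image hg using 1
  ext y
  constructor
  · rintro ⟨x, hx, rfl⟩
    refine ⟨StrongDual.toWeakDual (InnerProductSpace.toDual ℂ H x), ?_, ?_⟩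
    · simpa using hx
    · simp [g]
  · rintro ⟨ℓ, hℓ, rfl⟩
    refine ⟨_, ?_, rfl⟩
    simpa using hℓ

theorem WeakSpace.continuous_inner {H : Type*} [NormedAddCommGroup H] [InnerProductSpace ℂ H]
    (ξ : H) : Continuous fun y : WeakSpace ℂ H => ⟪(toWeakSpace ℂ H).symm y, ξ⟫_ℂ := by
  have h : Continuous fun y : WeakSpace ℂ H => ⟪ξ, (toWeakSpace ℂ H).symm y⟫_ℂ :=
    WeakBilin.eval_continuous (topDualPairing ℂ H).flip (innerSL ℂ ξ)
  exact (Complex.continuous_conj.comp h).congr fun y => inner_conj_symm _ _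

theorem ae_norm_le_one {H : Type*} [NormedAddCommGroup H] [MeasurableSpace H] [BorelSpace H]
    {μ : Measure H} [IsProbabilityMeasure μ] (hμ : μ (Metric.closedBall 0 1) = 1) :
    ∀ᵐ x ∂μ, ‖x‖ ≤ 1 := by
  have h := (prob_compl_eq_zero_iff Metric.isClosed_closedBall.measurableSet).2 hμ
  filter_upwards [measure_eq_zero_iff_ae_notMem.1 h] with x hx
  simpa using hx

/-- A weakly continuous function is integrable against every probability measure concentrated on
the closed unit ball. -/
theorem WeakSpace.integrable_of_continuous {H : Type*} [NormedAddCommGroup H]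
    [InnerProductSpace ℂ H] [CompleteSpace H] [TopologicalSpace.SeparableSpace H]
    [MeasurableSpace H] [BorelSpace H] {μ : Measure H} [IsProbabilityMeasure μ]
    (hμ : μ (Metric.closedBall 0 1) = 1) {f : WeakSpace ℂ H → ℝ} (hf : Continuous f) :
    Integrable (fun x => f (toWeakSpace ℂ H x)) μ := by
  have : SecondCountableTopology H := UniformSpace.secondCountable_of_separable H
  obtain ⟨C, hC⟩ :=
    (isCompact_toWeakSpace_image_closedBall H).exists_bound_of_continuousOn hf.continuousOn
  refine Integrable.of_bound
    (hf.comp (toWeakSpaceCLM ℂ H).continuous).aestronglyMeasurable C ?_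
  filter_upwards [ae_norm_le_one hμ] with x hx
  exact hC _ ⟨x, by simpa using hx, rfl⟩

theorem abs_integral_sub_integral_le {X : Type*} [MeasurableSpace X] {μ : Measure X}
    [IsProbabilityMeasure μ] {f g : X → ℝ} (hf : Integrable f μ) (hg : Integrable g μ) {ε : ℝ}
    (h : ∀ᵐ x ∂μ, |f x - g x| ≤ ε) : |∫ x, f x ∂μ - ∫ x, g x ∂μ| ≤ ε := by
  rw [← integral_sub hf hg]
  simpa using norm_integral_le_of_norm_le_const (f := fun x => f x - g x) h

/-- Convergence of integrals of weakly continuous functions passes to limits that are uniform on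
the closed unit ball. -/
theorem WeakSpace.tendsto_integral_of_approx {H : Type*} [NormedAddCommGroup H]
    [InnerProductSpace ℂ H] [CompleteSpace H] [TopologicalSpace.SeparableSpace H]
    [MeasurableSpace H] [BorelSpace H] {μ : ℕ → Measure H} {ν : Measure H}
    [∀ j, IsProbabilityMeasure (μ j)] [IsProbabilityMeasure ν]
    (hμ : ∀ j, μ j (Metric.closedBall 0 1) = 1) (hν : ν (Metric.closedBall 0 1) = 1)
    {f : WeakSpace ℂ H → ℝ} (hf : Continuous f)
    (h : ∀ ε > 0, ∃ g : WeakSpace ℂ H → ℝ, Continuous g ∧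
      (∀ x, ‖x‖ ≤ 1 → |g (toWeakSpace ℂ H x) - f (toWeakSpace ℂ H x)| ≤ ε) ∧
      Tendsto (fun j => ∫ x, g (toWeakSpace ℂ H x) ∂(μ j)) atTop
        (nhds (∫ x, g (toWeakSpace ℂ H x) ∂ν))) :
    Tendsto (fun j => ∫ x, f (toWeakSpace ℂ H x) ∂(μ j)) atTop
      (nhds (∫ x, f (toWeakSpace ℂ H x) ∂ν)) := by
  rw [Metric.tendsto_atTop]
  intro ε hε
  obtain ⟨g, hg, hgf, hlim⟩ := h (ε / 3) (by positivity)
  obtain ⟨N, hN⟩ := Metric.tendsto_atTop.1 hlim (ε / 3) (by positivity)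
  refine ⟨N, fun j hj => ?_⟩
  have h₁ := abs_integral_sub_integral_le (integrable_of_continuous (hμ j) hg)
    (integrable_of_continuous (hμ j) hf) ((ae_norm_le_one (hμ j)).mono hgf)
  have h₂ := abs_integral_sub_integral_le (integrable_of_continuous hν hg)
    (integrable_of_continuous hν hf) ((ae_norm_le_one hν).mono hgf)
  have h₃ := hN j hj
  rw [Real.dist_eq] at h₃ ⊢
  rw [abs_lt] at h₃ ⊢
  rw [abs_le] at h₁ h₂
  constructor <;> linarith

/-- The circle average of `exp (Re z)` over `‖z‖ = r`, multiplied by `2π`. -/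
noncomputable def circleExpIntegral (r : ℝ) : ℝ :=
  ∫ θ in (0 : ℝ)..2 * Real.pi, Real.exp (r * Real.cos θ)

theorem continuous_circleExpIntegral : Continuous circleExpIntegral :=
  intervalIntegral.continuous_parametric_intervalIntegral_of_continuous' (by fun_prop) _ _

theorem integral_exp_re_rotation (z : ℂ) :
    ∫ θ in (0 : ℝ)..2 * Real.pi, Real.exp (Complex.exp (-(θ * Complex.I)) * z).re =
      circleExpIntegral ‖z‖ := by
  have h (θ : ℝ) : (Complex.exp (-(θ * Complex.I)) * z).re = ‖z‖ * Real.cos (θ - z.arg) := by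
    conv_lhs => rw [← Complex.norm_mul_exp_arg_mul_I z]
    rw [mul_left_comm, ← Complex.exp_add, Complex.re_ofReal_mul,
      show -(θ * Complex.I) + z.arg * Complex.I = ((z.arg - θ : ℝ) : ℂ) * Complex.I by
        push_cast; ring,
      Complex.exp_ofReal_mul_I_re, ← Real.cos_neg, neg_sub]
  have hper : Function.Periodic (fun θ => Real.exp (‖z‖ * Real.cos θ)) (2 * Real.pi) :=
    fun θ => by simp
  simp_rw [h]
  rw [intervalIntegral.integral_comp_sub_right fun θ => Real.exp (‖z‖ * Real.cos θ),
    circleExpIntegral]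
  have := hper.intervalIntegral_add_eq (0 - z.arg) 0
  rw [zero_add] at this
  rw [← this]
  congr 1
  ring

/-- Rotation invariance turns exponential integrals into integrals of functions of the modulus. -/
theorem two_pi_mul_integral_exp_re_inner {H : Type*} [NormedAddCommGroup H]
    [InnerProductSpace ℂ H] [TopologicalSpace.SeparableSpace H]
    [MeasurableSpace H] [BorelSpace H] {μ : Measure H} [IsProbabilityMeasure μ]
    (hμ : μ (Metric.closedBall 0 1) = 1)
    (hinv : ∀ θ : ℝ, Measure.map (fun x : H => Complex.exp (θ * Complex.I) • x) μ = μ) (ξ : H) :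
    2 * Real.pi * ∫ x, Real.exp (⟪x, ξ⟫_ℂ).re ∂μ = ∫ x, circleExpIntegral ‖⟪x, ξ⟫_ℂ‖ ∂μ := by
  have : SecondCountableTopology H := UniformSpace.secondCountable_of_separable H
  have hrot (θ : ℝ) : ∫ x, Real.exp (Complex.exp (-(θ * Complex.I)) * ⟪x, ξ⟫_ℂ).re ∂μ =
      ∫ x, Real.exp (⟪x, ξ⟫_ℂ).re ∂μ := by
    conv_rhs => rw [← hinv θ]
    rw [integral_map (by fun_prop)
      (Continuous.aestronglyMeasurable (by fun_prop))]
    refine integral_congr_ae (.of_forall fun x => ?_)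
    simp only [inner_smul_left, ← Complex.exp_conj, map_mul, Complex.conj_ofReal, Complex.conj_I,
      mul_neg]
  have hint : Integrable (Function.uncurry fun (θ : ℝ) (x : H) =>
      Real.exp (Complex.exp (-(θ * Complex.I)) * ⟪x, ξ⟫_ℂ).re)
      ((volume.restrict (Set.uIoc 0 (2 * Real.pi))).prod μ) := by
    have : IsFiniteMeasure (volume.restrict (Set.uIoc 0 (2 * Real.pi))) :=
      ⟨by simp [Set.uIoc]⟩
    refine Integrable.of_bound (Continuous.aestronglyMeasurable ?_) (Real.exp ‖ξ‖) ?_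
    · unfold Function.uncurry
      fun_prop
    · filter_upwards [Measure.quasiMeasurePreserving_snd.ae (ae_norm_le_one hμ)] with p hp
      have hnorm : ‖Complex.exp (-(p.1 * Complex.I))‖ = 1 := by
        simp [Complex.norm_exp]
      rw [Function.uncurry, Real.norm_eq_abs, Real.abs_exp, Real.exp_le_exp]
      calc (Complex.exp (-(p.1 * Complex.I)) * ⟪p.2, ξ⟫_ℂ).re
          ≤ ‖Complex.exp (-(p.1 * Complex.I)) * ⟪p.2, ξ⟫_ℂ‖ := Complex.re_le_norm _
        _ = ‖⟪p.2, ξ⟫_ℂ‖ := by rw [norm_mul, hnorm, one_mul]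
        _ ≤ ‖p.2‖ * ‖ξ‖ := norm_inner_le_norm _ _
        _ ≤ ‖ξ‖ := mul_le_of_le_one_left (norm_nonneg _) hp
  have := intervalIntegral_integral_swap hint
  simp_rw [hrot, integral_exp_re_rotation] at this
  simpa using this

theorem WeakSpace.tendsto_integral_comp_norm_inner {H : Type*} [NormedAddCommGroup H]
    [InnerProductSpace ℂ H] [CompleteSpace H] [TopologicalSpace.SeparableSpace H]
    [MeasurableSpace H] [BorelSpace H] {μ : ℕ → Measure H} {ν : Measure H}
    [∀ j, IsProbabilityMeasure (μ j)] [IsProbabilityMeasure ν]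
    (hμ : ∀ j, μ j (Metric.closedBall 0 1) = 1) (hν : ν (Metric.closedBall 0 1) = 1) (ξ : H)
    (hmom : ∀ k : ℕ, Tendsto (fun j => ∫ x, ‖⟪x, ξ⟫_ℂ‖ ^ (2 * k) ∂(μ j)) atTop
      (nhds (∫ x, ‖⟪x, ξ⟫_ℂ‖ ^ (2 * k) ∂ν)))
    {G : ℝ → ℝ} (hG : Continuous G) :
    Tendsto (fun j => ∫ x, G ‖⟪x, ξ⟫_ℂ‖ ∂(μ j)) atTop (nhds (∫ x, G ‖⟪x, ξ⟫_ℂ‖ ∂ν)) := by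
  have hcont := continuous_inner ξ
  refine tendsto_integral_of_approx hμ hν
    (f := fun y => G ‖⟪(toWeakSpace ℂ H).symm y, ξ⟫_ℂ‖) (by fun_prop) fun ε hε => ?_
  obtain ⟨p, hp⟩ := exists_polynomial_near_of_continuousOn 0 (‖ξ‖ ^ 2) (fun s => G (√s))
    (by fun_prop) ε hε
  refine ⟨fun y => p.eval (‖⟪(toWeakSpace ℂ H).symm y, ξ⟫_ℂ‖ ^ 2), by fun_prop,
    fun x hx => ?_, ?_⟩
  · have hle : ‖⟪x, ξ⟫_ℂ‖ ≤ ‖ξ‖ :=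
      (norm_inner_le_norm _ _).trans (mul_le_of_le_one_left (norm_nonneg _) hx)
    have := hp (‖⟪x, ξ⟫_ℂ‖ ^ 2) ⟨by positivity, by gcongr⟩
    simpa [Real.sqrt_sq (norm_nonneg _)] using this.le
  · have heval {m : Measure H} [IsProbabilityMeasure m] (hm : m (Metric.closedBall 0 1) = 1) :
        ∫ x, p.eval (‖⟪x, ξ⟫_ℂ‖ ^ 2) ∂m =
          ∑ k ∈ Finset.range (p.natDegree + 1), p.coeff k * ∫ x, ‖⟪x, ξ⟫_ℂ‖ ^ (2 * k) ∂m := by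
      simp_rw [Polynomial.eval_eq_sum_range, ← pow_mul]
      rw [integral_finsetSum]
      · simp_rw [integral_const_mul]
      · intro k _
        exact (integrable_of_continuous hm
          (f := fun y => ‖⟪(toWeakSpace ℂ H).symm y, ξ⟫_ℂ‖ ^ (2 * k)) (by fun_prop)).const_mul _
    simp only [LinearEquiv.symm_apply_apply]
    rw [heval hν]
    simp_rw [fun j => heval (hμ j)]
    exact tendsto_finsetSum _ fun k _ => (hmom k).const_mul _

/-- The weakly continuous function `x ↦ exp (Re ⟪x, ξ⟫)`. -/
noncomputable def WeakSpace.expReInner {H : Type*} [NormedAddCommGroup H] [InnerProductSpace ℂ H]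
    (ξ : H) : C(WeakSpace ℂ H, ℝ) where
  toFun y := Real.exp (⟪(toWeakSpace ℂ H).symm y, ξ⟫_ℂ).re
  continuous_toFun := by
    have := continuous_inner ξ
    fun_prop

theorem WeakSpace.adjoin_range_expReInner (H : Type*) [NormedAddCommGroup H]
    [InnerProductSpace ℂ H] :
    Subalgebra.toSubmodule (Algebra.adjoin ℝ (Set.range (expReInner (H := H)))) =
      Submodule.span ℝ (Set.range (expReInner (H := H))) := by
  refine Algebra.adjoin_eq_span_of_subset ℝ (subset_trans (fun g hg => ?_) Submodule.subset_span)
  induction hg using Submonoid.closure_induction with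
  | mem g hg => exact hg
  | one => exact ⟨0, by ext; simp [expReInner]⟩
  | mul g₁ g₂ _ _ h₁ h₂ =>
    obtain ⟨ξ, rfl⟩ := h₁
    obtain ⟨η, rfl⟩ := h₂
    exact ⟨ξ + η, by ext; simp [expReInner, Real.exp_add]⟩

theorem WeakSpace.separatesPoints_adjoin_expReInner (H : Type*) [NormedAddCommGroup H]
    [InnerProductSpace ℂ H] :
    (Algebra.adjoin ℝ (Set.range (expReInner (H := H)))).SeparatesPoints := by
  intro y z hyz
  set u := (toWeakSpace ℂ H).symm y
  set v := (toWeakSpace ℂ H).symm z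
  have huv : u - v ≠ 0 := sub_ne_zero.2 ((toWeakSpace ℂ H).symm.injective.ne hyz)
  refine ⟨_, ⟨expReInner (u - v), Algebra.subset_adjoin ⟨_, rfl⟩, rfl⟩, fun h => huv ?_⟩
  have h' : (⟪u, u - v⟫_ℂ).re = (⟪v, u - v⟫_ℂ).re := Real.exp_injective h
  have hre : (⟪u - v, u - v⟫_ℂ).re = 0 := by
    rw [inner_sub_left, Complex.sub_re, h', sub_self]
  exact (re_inner_self_nonpos (𝕜 := ℂ)).1 hre.le

/-- **Weak narrow convergence is equivalent to convergence of all moments.**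
For `U(1)`-invariant Borel probability measures `(μ j)`, `ν` on a separable
complex Hilbert space, all concentrated on the closed unit ball, `μ j → ν`
weakly narrowly if and only if `∫ |⟨x,ξ⟩|^(2k) dμ j → ∫ |⟨x,ξ⟩|^(2k) dν` for
every `ξ ∈ H` and every `k ∈ ℕ`. -/
theorem weak_narrow_convergence_iff_moment_convergence
    {H : Type*} [NormedAddCommGroup H] [InnerProductSpace ℂ H] [CompleteSpace H]
    [TopologicalSpace.SeparableSpace H] [MeasurableSpace H] [BorelSpace H]
    (μ : ℕ → Measure H) (ν : Measure H)
    [∀ j, IsProbabilityMeasure (μ j)] [IsProbabilityMeasure ν]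
    (hμball : ∀ j, μ j (Metric.closedBall 0 1) = 1)
    (hνball : ν (Metric.closedBall 0 1) = 1)
    (hμinv : ∀ j, ∀ θ : ℝ,
      Measure.map (fun x : H => Complex.exp (θ * Complex.I) • x) (μ j) = μ j)
    (hνinv : ∀ θ : ℝ, Measure.map (fun x : H => Complex.exp (θ * Complex.I) • x) ν = ν) :
    (∀ f : H → ℝ, (∃ C : ℝ, ∀ x, |f x| ≤ C) →
        Continuous (X := WeakSpace ℂ H) f →
        Tendsto (fun j => ∫ x, f x ∂(μ j)) atTop (nhds (∫ x, f x ∂ν)))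
    ↔ (∀ ξ : H, ∀ k : ℕ,
        Tendsto (fun j => ∫ x, ‖⟪x, ξ⟫_ℂ‖ ^ (2 * k) ∂(μ j)) atTop
          (nhds (∫ x, ‖⟪x, ξ⟫_ℂ‖ ^ (2 * k) ∂ν))) := by
  constructor
  · intro h ξ k
    have hcont := WeakSpace.continuous_inner ξ
    have key {m : Measure H} [IsProbabilityMeasure m] (hm : m (Metric.closedBall 0 1) = 1) :
        ∫ x, min (‖⟪x, ξ⟫_ℂ‖ ^ (2 * k)) (‖ξ‖ ^ (2 * k)) ∂m = ∫ x, ‖⟪x, ξ⟫_ℂ‖ ^ (2 * k) ∂m := by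
      refine integral_congr_ae ((ae_norm_le_one hm).mono fun x hx => min_eq_left ?_)
      gcongr
      exact (norm_inner_le_norm _ _).trans (mul_le_of_le_one_left (norm_nonneg _) hx)
    have := h (fun x => min (‖⟪x, ξ⟫_ℂ‖ ^ (2 * k)) (‖ξ‖ ^ (2 * k)))
      ⟨‖ξ‖ ^ (2 * k), fun x => by
        rw [abs_of_nonneg (by positivity)]
        exact min_le_right _ _⟩
      ((hcont.norm.pow (2 * k)).min continuous_const)
    rw [key hνball] at this
    simpa only [fun j => key (hμball j)] using this
  · intro hmom f _ hf
    refine WeakSpace.tendsto_integral_of_approx hμball hνball (f := f) hf fun ε hε => ?_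
    obtain ⟨g, hg, hgf⟩ :=
      ContinuousMap.exists_mem_subalgebra_near_continuous_of_isCompact_of_separatesPoints
        (WeakSpace.separatesPoints_adjoin_expReInner H) ⟨f, hf⟩
        (isCompact_toWeakSpace_image_closedBall H) hε
    refine ⟨g, g.continuous, fun x hx => (hgf _ ⟨x, by simpa using hx, rfl⟩).le, ?_⟩
    rw [← Subalgebra.mem_toSubmodule, WeakSpace.adjoin_range_expReInner] at hg
    clear hgf
    induction hg using Submodule.span_induction with
    | mem g hg =>
      obtain ⟨ξ, rfl⟩ := hg
      have := WeakSpace.tendsto_integral_comp_norm_inner hμball hνball ξ (hmom ξ)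
        continuous_circleExpIntegral
      simp_rw [← two_pi_mul_integral_exp_re_inner hνball hνinv,
        fun j => (two_pi_mul_integral_exp_re_inner (hμball j) (hμinv j) ξ).symm] at this
      have hpi : (2 * Real.pi) ≠ 0 := by positivity
      replace this := this.const_mul (2 * Real.pi)⁻¹
      simp_rw [inv_mul_cancel_left₀ hpi] at this
      exact this
    | zero => simp
    | add g₁ g₂ _ _ h₁ h₂ =>
      simp_rw [ContinuousMap.add_apply,
        integral_add (WeakSpace.integrable_of_continuous hνball g₁.continuous)
          (WeakSpace.integrable_of_continuous hνball g₂.continuous),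
        fun j => integral_add (WeakSpace.integrable_of_continuous (hμball j) g₁.continuous)
          (WeakSpace.integrable_of_continuous (hμball j) g₂.continuous)]
      exact h₁.add h₂
    | smul c g _ h =>
      simp_rw [ContinuousMap.smul_apply, smul_eq_mul, integral_const_mul]
      exact h.const_mul c
end

section
/- Let H be a separable complex Hilbert space and let μ, ν be U(1)-invariant Borel probability measures on H, each concentrated on the closed unit ball X₁. If ∫ |⟨x,y⟩|^{2k} dμ(x) = ∫ |⟨x,y⟩|^{2k} dν(x) for every y ∈ H and every k ∈ ℕ, then μ = ν. -/
open MeasureTheory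
open scoped InnerProductSpace

section

variable {H : Type*} [NormedAddCommGroup H] [InnerProductSpace ℂ H]
  [MeasurableSpace H] [BorelSpace H]

theorem integral_inner_pow_mul_conj_inner_pow_eq_zero {μ : Measure H}
    (hinv : ∀ θ : ℝ, Measure.map (fun x : H => Complex.exp (θ * Complex.I) • x) μ = μ)
    (y : H) {k m : ℕ} (hkm : k ≠ m) :
    ∫ x, ⟪x, y⟫_ℂ ^ k * ⟪y, x⟫_ℂ ^ m ∂μ = 0 := by
  have hd : (m : ℂ) - k ≠ 0 := sub_ne_zero.2 (by exact_mod_cast hkm.symm)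
  set θ : ℝ := Real.pi / ((m : ℝ) - k) with hθ
  have hfactor : (starRingEnd ℂ) (Complex.exp (θ * Complex.I)) ^ k
      * Complex.exp (θ * Complex.I) ^ m = -1 := by
    rw [← Complex.exp_conj, ← Complex.exp_nat_mul, ← Complex.exp_nat_mul, ← Complex.exp_add,
      ← Complex.exp_pi_mul_I]
    congr 1
    simp only [map_mul, Complex.conj_ofReal, Complex.conj_I, hθ]
    push_cast
    field_simp
    ring
  have hmap : ∫ x, ⟪x, y⟫_ℂ ^ k * ⟪y, x⟫_ℂ ^ m ∂μ
      = -∫ x, ⟪x, y⟫_ℂ ^ k * ⟪y, x⟫_ℂ ^ m ∂μ := by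
    conv_lhs => rw [← hinv θ]
    rw [integral_map (by fun_prop)
      (Continuous.aestronglyMeasurable (by fun_prop)), ← integral_neg]
    congr 1 with x
    rw [inner_smul_left, inner_smul_right, mul_pow, mul_pow]
    linear_combination ⟪x, y⟫_ℂ ^ k * ⟪y, x⟫_ℂ ^ m * hfactor
  linear_combination hmap / 2

theorem ae_norm_inner_le_of_closedBall {μ : Measure H} [IsProbabilityMeasure μ]
    (hball : μ (Metric.closedBall 0 1) = 1) (y : H) : ∀ᵐ x ∂μ, ‖⟪x, y⟫_ℂ‖ ≤ ‖y‖ := by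
  have h : ∀ᵐ x ∂μ, x ∈ Metric.closedBall (0 : H) 1 :=
    mem_ae_iff_prob_eq_one (Metric.isClosed_closedBall.measurableSet) |>.2 hball
  filter_upwards [h] with x hx
  have hx' : ‖x‖ ≤ 1 := by simpa using hx
  exact (norm_inner_le_norm x y).trans (mul_le_of_le_one_left (norm_nonneg y) hx')

theorem integral_re_inner_pow {μ : Measure H} [IsProbabilityMeasure μ]
    (hball : μ (Metric.closedBall 0 1) = 1)
    (hinv : ∀ θ : ℝ, Measure.map (fun x : H => Complex.exp (θ * Complex.I) • x) μ = μ)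
    (y : H) (n : ℕ) :
    ∫ x, (((⟪x, y⟫_ℂ).re : ℝ) : ℂ) ^ n ∂μ
      = 2⁻¹ ^ n * ∑ k ∈ Finset.range (n + 1), if k = n - k then
          ((∫ x, ‖⟪x, y⟫_ℂ‖ ^ (2 * k) ∂μ : ℝ) : ℂ) * (n.choose k : ℂ) else 0 := by
  have hexp : ∀ x : H, (((⟪x, y⟫_ℂ).re : ℝ) : ℂ) ^ n = 2⁻¹ ^ n *
      ∑ k ∈ Finset.range (n + 1), ⟪x, y⟫_ℂ ^ k * ⟪y, x⟫_ℂ ^ (n - k) * (n.choose k : ℂ) := by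
    intro x
    rw [← add_pow, ← mul_pow, Complex.re_eq_add_conj, inner_conj_symm]
    ring
  simp_rw [hexp]
  rw [integral_const_mul, integral_finsetSum]
  · congr 1
    refine Finset.sum_congr rfl fun k _ => ?_
    rw [integral_mul_const]
    split_ifs with h
    · rw [← h, ← integral_complex_ofReal]
      congr 2 with x
      rw [← inner_conj_symm y x, ← mul_pow, Complex.mul_conj, Complex.normSq_eq_norm_sq, pow_mul]
      push_cast
      rfl
    · rw [integral_inner_pow_mul_conj_inner_pow_eq_zero hinv y h, zero_mul]
  · intro k _
    refine Integrable.mul_const (Integrable.of_bound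
      (Continuous.aestronglyMeasurable (by fun_prop)) (‖y‖ ^ k * ‖y‖ ^ (n - k)) ?_) _
    filter_upwards [ae_norm_inner_le_of_closedBall hball y] with x hx
    rw [norm_mul, norm_pow, norm_pow, norm_inner_symm y x]
    gcongr

theorem hasSum_integral_exp_re_inner {μ : Measure H} [IsProbabilityMeasure μ]
    (hball : μ (Metric.closedBall 0 1) = 1) (y : H) :
    HasSum (fun n : ℕ => (Complex.I ^ n / (n.factorial : ℂ)) *
        ∫ x, (((⟪x, y⟫_ℂ).re : ℝ) : ℂ) ^ n ∂μ)
      (∫ x, Complex.exp (((⟪x, y⟫_ℂ).re : ℝ) * Complex.I) ∂μ) := by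
  simp_rw [← integral_const_mul]
  refine hasSum_integral_of_dominated_convergence (fun n _ => ‖y‖ ^ n / n.factorial)
    (fun n => Continuous.aestronglyMeasurable (by fun_prop)) (fun n => ?_)
    (.of_forall fun x => Real.summable_pow_div_factorial ‖y‖) (integrable_const _)
    (.of_forall fun x => ?_)
  · filter_upwards [ae_norm_inner_le_of_closedBall hball y] with x hx
    have hre : |(⟪x, y⟫_ℂ).re| ≤ ‖y‖ := (Complex.abs_re_le_norm _).trans hx
    simp only [norm_mul, norm_div, norm_pow, Complex.norm_I, one_pow, Complex.norm_natCast,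
      Complex.norm_real, Real.norm_eq_abs]
    rw [one_div_mul_eq_div]
    gcongr
  · rw [Complex.exp_eq_exp_ℂ]
    convert! NormedSpace.expSeries_div_hasSum_exp (((⟪x, y⟫_ℂ).re : ℂ) * Complex.I) using 2 with n
    rw [mul_pow]
    ring

end

/-- **Uniqueness of `U(1)`-invariant measures from their moments (de Finetti uniqueness).**
If two `U(1)`-invariant Borel probability measures `μ`, `ν` on a separable
complex Hilbert space, both concentrated on the closed unit ball, have all
moments `∫ |⟨x,y⟩|^(2k) dμ = ∫ |⟨x,y⟩|^(2k) dν` equal (for every `y ∈ H` and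
`k ∈ ℕ`), then `μ = ν`. -/
theorem U1_invariant_measure_unique_from_moments
    {H : Type*} [NormedAddCommGroup H] [InnerProductSpace ℂ H] [CompleteSpace H]
    [TopologicalSpace.SeparableSpace H] [MeasurableSpace H] [BorelSpace H]
    (μ ν : Measure H) [IsProbabilityMeasure μ] [IsProbabilityMeasure ν]
    (hμball : μ (Metric.closedBall 0 1) = 1)
    (hνball : ν (Metric.closedBall 0 1) = 1)
    (hμinv : ∀ θ : ℝ, Measure.map (fun x : H => Complex.exp (θ * Complex.I) • x) μ = μ)
    (hνinv : ∀ θ : ℝ, Measure.map (fun x : H => Complex.exp (θ * Complex.I) • x) ν = ν)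
    (hmom : ∀ y : H, ∀ k : ℕ,
      ∫ x, ‖⟪x, y⟫_ℂ‖ ^ (2 * k) ∂μ = ∫ x, ‖⟪x, y⟫_ℂ‖ ^ (2 * k) ∂ν) :
    μ = ν := by
  have : SecondCountableTopology H := UniformSpace.secondCountable_of_separable H
  let _ : InnerProductSpace ℝ H := InnerProductSpace.rclikeToReal ℂ H
  refine Measure.ext_of_charFun (funext fun y => ?_)
  rw [charFun_apply, charFun_apply]
  refine (hasSum_integral_exp_re_inner hμball y).unique ?_
  change HasSum _ (∫ x, Complex.exp (((⟪x, y⟫_ℂ).re : ℝ) * Complex.I) ∂ν)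
  convert hasSum_integral_exp_re_inner hνball y using 3 with n
  rw [integral_re_inner_pow hμball hμinv, integral_re_inner_pow hνball hνinv]
  simp_rw [hmom y]
end

section
/- Let H be a separable complex Hilbert space with orthonormal basis (e_n)_{n∈ℕ}, and let I = [a,b] be a compact interval with a < b. On the product space 𝔛 = H × C(I,H), where C(I,H) is the space of continuous H-valued functions on I, consider the two metrics d((x,φ),(y,ψ)) = ‖x−y‖_H + sup_{t∈I} ‖φ(t)−ψ(t)‖_H and d_w((x,φ),(y,ψ)) = ‖x−y‖_w + sup_{t∈I} ‖φ(t)−ψ(t)‖_w, where ‖z‖_w := (Σ_{n∈ℕ} 2^{−n} |⟨e_n,z⟩|²)^{1/2}. Then the Borel σ-algebras of the topologies induced on 𝔛 by d and by d_w coincide: a subset of 𝔛 is Borel for one metric if and only if it is Borel for the other. -/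
open MeasureTheory
open scoped InnerProductSpace

/-- The weak norm `(∑ₙ 2⁻ⁿ |⟨eₙ,z⟩|²)^{1/2}` attached to a family of vectors. -/
noncomputable def weakNorm {H : Type*} [NormedAddCommGroup H] [InnerProductSpace ℂ H]
    (e : ℕ → H) (z : H) : ℝ :=
  Real.sqrt (∑' n : ℕ, (2 : ℝ)⁻¹ ^ n * ‖⟪e n, z⟫_ℂ‖ ^ 2)

section WeakNorm

variable {H : Type*} [NormedAddCommGroup H] [InnerProductSpace ℂ H] {e : ℕ → H}

lemma weakNorm_term_le (he : ∀ n, ‖e n‖ ≤ 1) (z : H) (n : ℕ) :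
    (2 : ℝ)⁻¹ ^ n * ‖⟪e n, z⟫_ℂ‖ ^ 2 ≤ (2 : ℝ)⁻¹ ^ n * ‖z‖ ^ 2 := by
  have h : ‖⟪e n, z⟫_ℂ‖ ≤ ‖z‖ :=
    (norm_inner_le_norm _ _).trans (mul_le_of_le_one_left (norm_nonneg z) (he n))
  gcongr

lemma hasSum_two_inv_pow : HasSum (fun n : ℕ => (2 : ℝ)⁻¹ ^ n) 2 := by
  simpa only [one_div] using hasSum_geometric_two

lemma summable_weakNorm (he : ∀ n, ‖e n‖ ≤ 1) (z : H) :
    Summable fun n : ℕ => (2 : ℝ)⁻¹ ^ n * ‖⟪e n, z⟫_ℂ‖ ^ 2 :=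
  .of_nonneg_of_le (fun _ => by positivity) (weakNorm_term_le he z)
    (hasSum_two_inv_pow.summable.mul_right _)

lemma weakNorm_nonneg (z : H) : 0 ≤ weakNorm e z := Real.sqrt_nonneg _

lemma weakNorm_le (he : ∀ n, ‖e n‖ ≤ 1) (z : H) : weakNorm e z ≤ 2 * ‖z‖ := by
  refine Real.sqrt_le_iff.2 ⟨by positivity, ?_⟩
  have h := (summable_weakNorm he z).tsum_le_tsum (weakNorm_term_le he z)
    (hasSum_two_inv_pow.summable.mul_right _)
  rw [(hasSum_two_inv_pow.mul_right _).tsum_eq] at h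
  nlinarith [sq_nonneg ‖z‖]

lemma norm_inner_le_weakNorm (he : ∀ n, ‖e n‖ ≤ 1) (k : ℕ) (z : H) :
    ‖⟪e k, z⟫_ℂ‖ ≤ 2 ^ k * weakNorm e z := by
  have h := (summable_weakNorm he z).le_tsum k fun _ _ => by positivity
  have hs : weakNorm e z ^ 2 = ∑' n : ℕ, (2 : ℝ)⁻¹ ^ n * ‖⟪e n, z⟫_ℂ‖ ^ 2 :=
    Real.sq_sqrt (tsum_nonneg fun _ => by positivity)
  rw [← hs, inv_pow, inv_mul_le_iff₀ (by positivity)] at h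
  refine le_of_sq_le_sq ?_ (by have := weakNorm_nonneg (e := e) z; positivity)
  have h1 : (1 : ℝ) ≤ 2 ^ k := one_le_pow₀ one_le_two
  nlinarith [mul_nonneg (sub_nonneg.2 h1)
    (mul_nonneg (zero_le_one.trans h1) (sq_nonneg (weakNorm e z)))]

lemma bddAbove_weakNorm_sub {X : Type*} [TopologicalSpace X] [CompactSpace X]
    (he : ∀ n, ‖e n‖ ≤ 1) (f g : C(X, H)) :
    BddAbove (Set.range fun t => weakNorm e (f t - g t)) := by
  refine ⟨2 * ‖f - g‖, ?_⟩
  rintro _ ⟨t, rfl⟩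
  exact (weakNorm_le he _).trans (by gcongr; exact (f - g).norm_coe_le_norm t)

end WeakNorm

/-- A function into a Borel space that is Lipschitz for a gauge `ρ` is measurable for the
σ-algebra generated by the `ρ`-open sets. -/
lemma measurable_generateFrom_of_dist_le {X Y : Type*} [PseudoMetricSpace Y] [MeasurableSpace Y]
    [BorelSpace Y] (ρ : X → X → ℝ) (f : X → Y) {C : ℝ} (hC : 0 < C)
    (hf : ∀ p q, dist (f q) (f p) ≤ C * ρ p q) :
    Measurable[MeasurableSpace.generateFrom
      {s : Set X | ∀ p ∈ s, ∃ ε > (0 : ℝ), ∀ q, ρ p q < ε → q ∈ s}] f := by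
  refine @measurable_of_isOpen _ _ _ _ _ (_) _ fun u hu => ?_
  refine MeasurableSpace.measurableSet_generateFrom fun p hp => ?_
  obtain ⟨ε, hε, hball⟩ := Metric.isOpen_iff.1 hu (f p) hp
  refine ⟨ε / C, div_pos hε hC, fun q hq => hball ?_⟩
  rw [lt_div_iff₀' hC] at hq
  exact (hf p q).trans_lt hq

/-- A map into a separable Hilbert space is measurable if all its coordinates are. -/
lemma HilbertBasis.measurable_of_inner {X H : Type*} [MeasurableSpace X] [NormedAddCommGroup H]
    [InnerProductSpace ℂ H] [SecondCountableTopology H] [MeasurableSpace H] [BorelSpace H]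
    (e : HilbertBasis ℕ ℂ H) {f : X → H} (hf : ∀ n, Measurable fun x => ⟪e n, f x⟫_ℂ) :
    Measurable f := by
  refine measurable_of_tendsto_metrizable
    (f := fun N x => ∑ n ∈ Finset.range N, ⟪e n, f x⟫_ℂ • e n) (fun N => ?_) ?_
  · exact Finset.measurable_fun_sum _ fun n _ => (hf n).smul_const _
  · refine tendsto_pi_nhds.2 fun x => ?_
    have h := (e.hasSum_repr (f x)).tendsto_sum_nat
    simpa only [e.repr_apply_apply] using h

/-- A map into `C(X, Y)` is measurable if all its evaluations are. -/
lemma ContinuousMap.measurable_of_eval {Ω X Y : Type*} [MeasurableSpace Ω] [TopologicalSpace X]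
    [CompactSpace X] [SecondCountableTopology X] [LocallyCompactSpace X] [MetricSpace Y]
    [SecondCountableTopology Y] [MeasurableSpace Y] [BorelSpace Y]
    [MeasurableSpace C(X, Y)] [BorelSpace C(X, Y)] {f : Ω → C(X, Y)}
    (hf : ∀ x, Measurable fun ω => f ω x) : Measurable f := by
  have hdist (g : C(X, Y)) : Measurable fun ω => dist (f ω) g := by
    refine measurable_of_Iic fun c => ?_
    obtain ⟨S, hS, hd⟩ := TopologicalSpace.exists_countable_dense X
    rcases lt_or_ge c 0 with hc | hc
    · convert MeasurableSet.empty using 1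
      exact Set.eq_empty_of_forall_notMem fun ω h => (hc.trans_le dist_nonneg).not_ge h
    · have hset : (fun ω => dist (f ω) g) ⁻¹' Set.Iic c =
          ⋂ x ∈ S, {ω | dist (f ω x) (g x) ≤ c} := by
        ext ω
        simp only [Set.mem_preimage, Set.mem_Iic, ContinuousMap.dist_le hc, Set.mem_iInter,
          Set.mem_ofPred_eq]
        refine ⟨fun h x _ => h x, fun h x => ?_⟩
        have hcl : IsClosed {x | dist (f ω x) (g x) ≤ c} :=
          isClosed_le (by fun_prop) continuous_const
        exact hcl.closure_subset_iff.2 h (hd x)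
      rw [hset]
      exact .biInter hS fun x _ => ((hf x).dist measurable_const) measurableSet_Iic
  refine measurable_of_isOpen fun u hu => ?_
  obtain ⟨S, hS, hd⟩ := TopologicalSpace.exists_countable_dense C(X, Y)
  have hset : f ⁻¹' u =
      ⋃ g ∈ S, ⋃ q ∈ {q : ℚ | Metric.ball g q ⊆ u}, {ω | dist (f ω) g < q} := by
    ext ω
    simp only [Set.mem_preimage, Set.mem_iUnion, Set.mem_ofPred_eq, exists_prop]
    refine ⟨fun h => ?_, fun ⟨g, _, q, hq, hlt⟩ => hq hlt⟩
    obtain ⟨ε, hε, hball⟩ := Metric.isOpen_iff.1 hu _ h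
    obtain ⟨q, hq0, hq⟩ := exists_rat_btwn (half_pos hε)
    obtain ⟨g, hg, hlt⟩ := hd.exists_dist_lt (f ω) hq0
    refine ⟨g, hg, q, fun k hk => hball ?_, hlt⟩
    have htri := dist_triangle k g (f ω)
    rw [Metric.mem_ball] at hk ⊢
    rw [dist_comm] at hlt
    linarith
  rw [hset]
  exact .biUnion hS fun g _ => .biUnion (Set.to_countable _) fun q _ => hdist g measurableSet_Iio

/-- **The Borel σ-algebras of the strong and weak metrics on `H × C(I,H)` coincide.**
On `𝔛 = H × C([a,b], H)`, consider the metric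
`d((x,φ),(y,ψ)) = ‖x-y‖ + sup_t ‖φ t - ψ t‖` and the weak metric
`d_w((x,φ),(y,ψ)) = ‖x-y‖_w + sup_t ‖φ t - ψ t‖_w`, where
`‖z‖_w = (∑ₙ 2⁻ⁿ |⟨eₙ,z⟩|²)^{1/2}` for a Hilbert basis `(eₙ)`.
Then a subset of `𝔛` is Borel for `d` iff it is Borel for `d_w`:
the σ-algebras generated by the `d`-open and the `d_w`-open sets coincide. -/
theorem borel_sigma_algebras_of_strong_and_weak_metrics_coincide
    {H : Type*} [NormedAddCommGroup H] [InnerProductSpace ℂ H] [CompleteSpace H]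
    [TopologicalSpace.SeparableSpace H]
    (e : HilbertBasis ℕ ℂ H)
    (a b : ℝ) (hab : a < b)
    (wnorm : H → ℝ)
    (hwnorm : ∀ z : H,
      wnorm z = Real.sqrt (∑' n : ℕ, (2 : ℝ)⁻¹ ^ n * ‖⟪(e n : H), z⟫_ℂ‖ ^ 2))
    (d dw : (H × C(Set.Icc a b, H)) → (H × C(Set.Icc a b, H)) → ℝ)
    (hd : ∀ p q : H × C(Set.Icc a b, H),
      d p q = ‖p.1 - q.1‖ + ⨆ t : Set.Icc a b, ‖p.2 t - q.2 t‖)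
    (hdw : ∀ p q : H × C(Set.Icc a b, H),
      dw p q = wnorm (p.1 - q.1) + ⨆ t : Set.Icc a b, wnorm (p.2 t - q.2 t)) :
    MeasurableSpace.generateFrom
        {s : Set (H × C(Set.Icc a b, H)) | ∀ p ∈ s, ∃ ε > (0 : ℝ), ∀ q, d p q < ε → q ∈ s}
      = MeasurableSpace.generateFrom
        {s : Set (H × C(Set.Icc a b, H)) | ∀ p ∈ s, ∃ ε > (0 : ℝ), ∀ q, dw p q < ε → q ∈ s} := by
  obtain rfl : wnorm = weakNorm (fun n => e n) := funext hwnorm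
  have he : ∀ n, ‖e n‖ ≤ 1 := fun n => (e.orthonormal.norm_eq_one n).le
  apply le_antisymm
  · refine MeasurableSpace.generateFrom_le fun s hs => ?_
    have hopen : IsOpen s := by
      refine Metric.isOpen_iff.2 fun p hp => ?_
      obtain ⟨ε, hε, h⟩ := hs p hp
      refine ⟨ε / 2, half_pos hε, fun q hq => h q ?_⟩
      have hsup : ⨆ t, ‖p.2 t - q.2 t‖ ≤ dist q p :=
        Real.iSup_le (fun t => by
          rw [← dist_eq_norm, dist_comm]
          exact (ContinuousMap.dist_apply_le_dist t).trans (le_max_right _ _)) dist_nonneg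
      have hfst : ‖p.1 - q.1‖ ≤ dist q p := by
        rw [← dist_eq_norm, dist_comm]
        exact le_max_left _ _
      rw [hd]
      linarith [Metric.mem_ball.1 hq]
    borelize H
    let : MeasurableSpace C(Set.Icc a b, H) := borel _
    have : BorelSpace C(Set.Icc a b, H) := ⟨rfl⟩
    have : SecondCountableTopology H := UniformSpace.secondCountable_of_separable H
    have hopen_meas : MeasurableSet s := hopen.measurableSet
    let m := MeasurableSpace.generateFrom
      {s : Set (H × C(Set.Icc a b, H)) | ∀ p ∈ s, ∃ ε > (0 : ℝ), ∀ q, dw p q < ε → q ∈ s}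
    have hfst : Measurable[m] fun p : H × C(Set.Icc a b, H) => p.1 := by
      refine e.measurable_of_inner fun n => ?_
      refine measurable_generateFrom_of_dist_le dw _ (C := 2 ^ n) (by positivity) fun p q => ?_
      rw [dist_comm, dist_eq_norm, ← inner_sub_right, hdw]
      refine (norm_inner_le_weakNorm he n _).trans ?_
      gcongr
      exact le_add_of_nonneg_right (Real.iSup_nonneg fun t => weakNorm_nonneg _)
    have heval : ∀ t, Measurable[m] fun p : H × C(Set.Icc a b, H) => p.2 t := by
      refine fun t => e.measurable_of_inner fun n => ?_
      refine measurable_generateFrom_of_dist_le dw _ (C := 2 ^ n) (by positivity) fun p q => ?_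
      rw [dist_comm, dist_eq_norm, ← inner_sub_right, hdw]
      refine (norm_inner_le_weakNorm he n _).trans ?_
      gcongr
      exact (le_ciSup (bddAbove_weakNorm_sub he p.2 q.2) t).trans
        (le_add_of_nonneg_left (weakNorm_nonneg _))
    have hsnd : Measurable[m] fun p : H × C(Set.Icc a b, H) => p.2 :=
      ContinuousMap.measurable_of_eval heval
    have hid : Measurable[m, Prod.instMeasurableSpace]
        fun p : H × C(Set.Icc a b, H) => (p.1, p.2) := hfst.prodMk hsnd
    exact hid hopen_meas
  · refine MeasurableSpace.generateFrom_mono fun s hs p hp => ?_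
    obtain ⟨ε, hε, h⟩ := hs p hp
    refine ⟨ε / 2, half_pos hε, fun q hq => h q ?_⟩
    have hbdd : BddAbove (Set.range fun t => ‖p.2 t - q.2 t‖) :=
      ⟨‖p.2 - q.2‖, by rintro _ ⟨t, rfl⟩; exact (p.2 - q.2).norm_coe_le_norm t⟩
    have hsup : ⨆ t, weakNorm (fun n => e n) (p.2 t - q.2 t) ≤ 2 * ⨆ t, ‖p.2 t - q.2 t‖ :=
      Real.iSup_le (fun t => (weakNorm_le he _).trans (by gcongr; exact le_ciSup hbdd t))
        (mul_nonneg zero_le_two (Real.iSup_nonneg fun t => norm_nonneg _))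
    rw [hd] at hq
    rw [hdw]
    linarith [weakNorm_le he (p.1 - q.1)]
end

section
/- Let g : ℂ → ℂ be continuously differentiable when viewed as a map ℝ² → ℝ², with g(0) = 0, and suppose there exist α ≥ 0 and M > 0 such that the operator norm of the (real) derivative satisfies ‖Dg(ξ)‖ ≤ M|ξ|^α for every ξ ∈ ℂ with |ξ| ≥ 1. Then there exist functions g₁, g₂ : ℂ → ℂ and a constant M' > 0 such that g = g₁ + g₂, g₁(0) = g₂(0) = 0, |g₁(ξ) − g₁(η)| ≤ M'|ξ − η| for all ξ, η ∈ ℂ, and |g₂(ξ) − g₂(η)| ≤ M'|ξ − η|·max(|ξ|^α, |η|^α) for all ξ, η ∈ ℂ. -/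
/-- The radial retraction onto the closed unit ball is `2`-Lipschitz. -/
theorem norm_radial_sub_radial_le {E : Type*} [NormedAddCommGroup E] [NormedSpace ℝ E] (x y : E) :
    ‖(max 1 ‖x‖)⁻¹ • x - (max 1 ‖y‖)⁻¹ • y‖ ≤ 2 * ‖x - y‖ := by
  set a := max 1 ‖x‖ with ha
  set b := max 1 ‖y‖ with hb
  have ha1 : 1 ≤ a := le_max_left _ _
  have hb1 : 1 ≤ b := le_max_left _ _
  have hyb : ‖y‖ ≤ b := le_max_right _ _
  have ha0 : 0 < a := by linarith
  have hb0 : 0 < b := by linarith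
  have hab : |b - a| ≤ ‖x - y‖ := by
    have h := abs_max_sub_max_le_max 1 ‖y‖ 1 ‖x‖
    rw [← ha, ← hb, sub_self, abs_zero, max_eq_right (abs_nonneg _)] at h
    exact h.trans (by rw [abs_sub_comm]; exact abs_norm_sub_norm_le x y)
  have hsplit : a⁻¹ • x - b⁻¹ • y = a⁻¹ • ((x - y) + ((b - a) * b⁻¹) • y) := by
    rw [smul_add, smul_sub, smul_smul, sub_add, ← sub_smul]
    congr 2
    field_simp
    ring
  have hy : ‖((b - a) * b⁻¹) • y‖ ≤ ‖x - y‖ := by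
    rw [norm_smul, norm_mul, norm_inv, Real.norm_eq_abs, Real.norm_of_nonneg hb0.le, mul_assoc]
    have : b⁻¹ * ‖y‖ ≤ 1 := by
      rw [inv_mul_le_iff₀ hb0, mul_one]
      exact hyb
    exact (mul_le_of_le_one_right (abs_nonneg _) this).trans hab
  rw [hsplit, norm_smul, norm_inv, Real.norm_of_nonneg ha0.le]
  calc a⁻¹ * ‖(x - y) + ((b - a) * b⁻¹) • y‖
      ≤ ‖(x - y) + ((b - a) * b⁻¹) • y‖ :=
        mul_le_of_le_one_left (norm_nonneg _) (inv_le_one_of_one_le₀ ha1)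
    _ ≤ 2 * ‖x - y‖ := by linarith [norm_add_le (x - y) (((b - a) * b⁻¹) • y)]

/-- The radial retraction takes values in the closed unit ball. -/
theorem norm_radial_le_one {E : Type*} [NormedAddCommGroup E] [NormedSpace ℝ E] (x : E) :
    ‖(max 1 ‖x‖)⁻¹ • x‖ ≤ 1 := by
  have h : 0 < max 1 ‖x‖ := lt_max_of_lt_left one_pos
  rw [norm_smul, norm_inv, Real.norm_of_nonneg h.le, inv_mul_le_iff₀ h, mul_one]
  exact le_max_right _ _

/-- **Decomposition of a `C¹` nonlinearity with polynomially bounded derivative.**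
If `g : ℂ → ℂ` is `C¹` as a map `ℝ² → ℝ²`, `g 0 = 0`, and the (real) derivative
satisfies `‖Dg(ξ)‖ ≤ M ‖ξ‖^α` for `‖ξ‖ ≥ 1`, then `g = g₁ + g₂` with
`g₁ 0 = g₂ 0 = 0`, `g₁` Lipschitz and
`|g₂ ξ - g₂ η| ≤ M' |ξ - η| max(|ξ|^α, |η|^α)`. -/
theorem C1_nonlinearity_decomposition
    (g : ℂ → ℂ) (hg : ContDiff ℝ 1 g) (hg0 : g 0 = 0)
    (α : ℝ) (hα : 0 ≤ α) (M : ℝ) (hM : 0 < M)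
    (hder : ∀ ξ : ℂ, 1 ≤ ‖ξ‖ → ‖fderiv ℝ g ξ‖ ≤ M * ‖ξ‖ ^ α) :
    ∃ (g₁ g₂ : ℂ → ℂ) (M' : ℝ), 0 < M' ∧
      (∀ ξ : ℂ, g ξ = g₁ ξ + g₂ ξ) ∧
      g₁ 0 = 0 ∧ g₂ 0 = 0 ∧
      (∀ ξ η : ℂ, ‖g₁ ξ - g₁ η‖ ≤ M' * ‖ξ - η‖) ∧
      (∀ ξ η : ℂ, ‖g₂ ξ - g₂ η‖ ≤ M' * ‖ξ - η‖ * max (‖ξ‖ ^ α) (‖η‖ ^ α)) := by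
  have hd : Differentiable ℝ g := hg.differentiable one_ne_zero
  obtain ⟨K, hK⟩ := (isCompact_closedBall (0 : ℂ) 1).exists_bound_of_continuousOn
    (hg.continuous_fderiv one_ne_zero).continuousOn
  simp only [mem_closedBall_zero_iff] at hK
  have hK0 : 0 ≤ K := (norm_nonneg _).trans (hK 0 (by simp))
  have hlip : ∀ (R C : ℝ), (∀ z : ℂ, ‖z‖ ≤ R → ‖fderiv ℝ g z‖ ≤ C) →
      ∀ x y : ℂ, ‖x‖ ≤ R → ‖y‖ ≤ R → ‖g x - g y‖ ≤ C * ‖x - y‖ := by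
    intro R C hC x y hx hy
    exact (convex_closedBall (0 : ℂ) R).norm_image_sub_le_of_norm_fderiv_le (𝕜 := ℝ)
      (fun z _ => hd z) (fun z hz => hC z (mem_closedBall_zero_iff.1 hz))
      (mem_closedBall_zero_iff.2 hy) (mem_closedBall_zero_iff.2 hx)
  let P : ℂ → ℂ := fun z => (max 1 ‖z‖)⁻¹ • z
  have hP_of_le : ∀ z : ℂ, ‖z‖ ≤ 1 → P z = z := fun z hz => by
    simp [P, max_eq_left hz]
  have hg₁ : ∀ ξ η : ℂ, ‖g (P ξ) - g (P η)‖ ≤ 2 * K * ‖ξ - η‖ := fun ξ η => by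
    have h := hlip 1 K hK (P ξ) (P η) (norm_radial_le_one ξ) (norm_radial_le_one η)
    have h' := mul_le_mul_of_nonneg_left (norm_radial_sub_radial_le ξ η) hK0
    linarith
  refine ⟨g ∘ P, fun z => g z - g (P z), 3 * K + M, by positivity, fun ξ => by simp,
    by simp [P, hg0], by simp [P, hg0], fun ξ η => (hg₁ ξ η).trans ?_, fun ξ η => ?_⟩
  · gcongr
    linarith
  set R := max ‖ξ‖ ‖η‖ with hR
  have hξ : ‖ξ‖ ≤ R := le_max_left _ _
  have hη : ‖η‖ ≤ R := le_max_right _ _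
  rcases le_total R 1 with hR1 | hR1
  · simp only [hP_of_le ξ (hξ.trans hR1), hP_of_le η (hη.trans hR1), sub_self, norm_zero]
    positivity
  have hmax : R ^ α ≤ max (‖ξ‖ ^ α) (‖η‖ ^ α) := by
    rcases max_choice ‖ξ‖ ‖η‖ with h | h
    · rw [hR, h]; exact le_max_left _ _
    · rw [hR, h]; exact le_max_right _ _
  have hRα : 1 ≤ R ^ α := Real.one_le_rpow hR1 hα
  have hbound : ∀ z : ℂ, ‖z‖ ≤ R → ‖fderiv ℝ g z‖ ≤ K + M * R ^ α := by
    intro z hz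
    rcases le_total ‖z‖ 1 with h | h
    · exact (hK z h).trans (le_add_of_nonneg_right (by positivity))
    · have : M * ‖z‖ ^ α ≤ M * R ^ α := by gcongr
      linarith [hder z h]
  calc ‖g ξ - g (P ξ) - (g η - g (P η))‖
      = ‖(g ξ - g η) - (g (P ξ) - g (P η))‖ := by congr 1; ring
    _ ≤ (K + M * R ^ α) * ‖ξ - η‖ + 2 * K * ‖ξ - η‖ :=
        (norm_sub_le _ _).trans (add_le_add (hlip R _ hbound ξ η hξ hη) (hg₁ ξ η))
    _ = (3 * K + M * R ^ α) * ‖ξ - η‖ := by ring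
    _ ≤ (3 * K * R ^ α + M * R ^ α) * ‖ξ - η‖ := by
        gcongr ?_ * _
        linarith [le_mul_of_one_le_right (mul_nonneg zero_le_three hK0) hRα]
    _ = (3 * K + M) * ‖ξ - η‖ * R ^ α := by ring
    _ ≤ (3 * K + M) * ‖ξ - η‖ * max (‖ξ‖ ^ α) (‖η‖ ^ α) := by gcongr
end

section
/- Let H be a separable complex Hilbert space with orthonormal basis (e_i)_{i∈ℕ}, and let (μ_n)_{n∈ℕ} and μ be Borel probability measures on H, each concentrated on the closed unit ball X₁. Assume that μ_n converges weakly narrowly to μ and that sup_{N∈ℕ} | ∫ Σ_{i=N}^∞ |⟨x,e_i⟩|² dμ_n(x) − ∫ Σ_{i=N}^∞ |⟨x,e_i⟩|² dμ(x) | → 0 as n → ∞. Then μ_n converges strongly narrowly to μ, i.e. ∫ f dμ_n → ∫ f dμ for every bounded function f : H → ℝ that is continuous with respect to the norm topology of H. -/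
open MeasureTheory Filter
open scoped InnerProductSpace

namespace HilbertBasis

variable {H : Type*} [NormedAddCommGroup H] [InnerProductSpace ℂ H] (e : HilbertBasis ℕ ℂ H)

/-- The truncation of the expansion of `x` in the Hilbert basis `e` to its first `N` terms. -/
noncomputable def truncation (N : ℕ) (x : H) : H :=
  ∑ i ∈ Finset.range N, ⟪(e i : H), x⟫_ℂ • (e i : H)

lemma continuous_truncation (N : ℕ) : Continuous (e.truncation N) := by
  unfold truncation
  fun_prop

lemma continuous_weakSpace_truncation (N : ℕ) :
    Continuous (X := WeakSpace ℂ H) (e.truncation N) := by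
  unfold truncation
  refine continuous_finsetSum (X := WeakSpace ℂ H) _ fun i _ => ?_
  have h : Continuous (X := WeakSpace ℂ H) fun x : H => ⟪(e i : H), x⟫_ℂ :=
    WeakBilin.eval_continuous (topDualPairing ℂ H).flip (innerSL ℂ (e i : H))
  exact h.smul (continuous_const (Y := H))

lemma tendsto_truncation (x : H) : Tendsto (fun N => e.truncation N x) atTop (nhds x) := by
  simpa [truncation, e.repr_apply_apply] using (e.hasSum_repr x).tendsto_sum_nat

lemma hasSum_sq_norm_inner (x : H) :
    HasSum (fun i => ‖⟪x, (e i : H)⟫_ℂ‖ ^ 2) (‖x‖ ^ 2) := by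
  have h := Complex.hasSum_re (e.hasSum_inner_mul_inner x x)
  convert! h using 1
  · ext i
    rw [← inner_conj_symm (e i : H) x, Complex.mul_conj, Complex.ofReal_re,
      Complex.normSq_eq_norm_sq]
  · exact norm_sq_eq_re_inner (𝕜 := ℂ) x

lemma inner_sub_truncation (N i : ℕ) (x : H) :
    ⟪x - e.truncation N x, (e i : H)⟫_ℂ = if N ≤ i then ⟪x, (e i : H)⟫_ℂ else 0 := by
  have he := orthonormal_iff_ite.mp e.orthonormal
  rw [truncation, inner_sub_left, sum_inner]
  simp only [inner_smul_left, he, inner_conj_symm, mul_ite, mul_one, mul_zero,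
    Finset.sum_ite_eq', Finset.mem_range]
  split_ifs <;> first | omega | simp

lemma hasSum_tail_sq_norm_inner (N : ℕ) (x : H) :
    HasSum (fun i => if N ≤ i then ‖⟪x, (e i : H)⟫_ℂ‖ ^ 2 else 0)
      (‖x - e.truncation N x‖ ^ 2) := by
  convert! e.hasSum_sq_norm_inner (x - e.truncation N x) using 1
  ext i
  rw [inner_sub_truncation]
  split_ifs <;> simp

lemma norm_sub_truncation_le (N : ℕ) (x : H) : ‖x - e.truncation N x‖ ≤ ‖x‖ := by
  refine (sq_le_sq₀ (norm_nonneg _) (norm_nonneg _)).mp ?_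
  refine hasSum_le (fun i => ?_) (e.hasSum_tail_sq_norm_inner N x) (e.hasSum_sq_norm_inner x)
  split_ifs
  · exact le_rfl
  · positivity

section Measure

variable [MeasurableSpace H] [BorelSpace H] {ρ : Measure H} [IsProbabilityMeasure ρ]

lemma ae_sq_norm_sub_truncation_le_one (hρ : ρ (Metric.closedBall 0 1) = 1) (N : ℕ) :
    ∀ᵐ x ∂ρ, ‖x - e.truncation N x‖ ^ 2 ≤ 1 := by
  filter_upwards [(prob_compl_eq_zero_iff Metric.isClosed_closedBall.measurableSet).mpr hρ]
    with x hx
  rw [mem_closedBall_zero_iff] at hx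
  exact pow_le_one₀ (norm_nonneg _) ((e.norm_sub_truncation_le N x).trans hx)

lemma integrable_sq_norm_sub_truncation (hρ : ρ (Metric.closedBall 0 1) = 1) (N : ℕ) :
    Integrable (fun x => ‖x - e.truncation N x‖ ^ 2) ρ := by
  refine .of_bound (C := 1) ?_ ?_
  · exact ((continuous_id.sub (e.continuous_truncation N)).norm.pow 2).aestronglyMeasurable
  · filter_upwards [e.ae_sq_norm_sub_truncation_le_one hρ N] with x hx
    rwa [Real.norm_of_nonneg (by positivity)]

lemma integral_sq_norm_sub_truncation_le_one (hρ : ρ (Metric.closedBall 0 1) = 1) (N : ℕ) :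
    ∫ x, ‖x - e.truncation N x‖ ^ 2 ∂ρ ≤ 1 := by
  simpa using integral_mono_ae (e.integrable_sq_norm_sub_truncation hρ N) (integrable_const 1)
    (e.ae_sq_norm_sub_truncation_le_one hρ N)

lemma tendsto_integral_sq_norm_sub_truncation (hρ : ρ (Metric.closedBall 0 1) = 1) :
    Tendsto (fun N => ∫ x, ‖x - e.truncation N x‖ ^ 2 ∂ρ) atTop (nhds 0) := by
  rw [← integral_zero H ℝ (μ := ρ)]
  refine tendsto_integral_of_dominated_convergence (fun _ => 1)
    (fun N => (e.integrable_sq_norm_sub_truncation hρ N).aestronglyMeasurable)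
    (integrable_const 1) (fun N => ?_) (.of_forall fun x => ?_)
  · filter_upwards [e.ae_sq_norm_sub_truncation_le_one hρ N] with x hx
    rwa [Real.norm_of_nonneg (by positivity)]
  · simpa using ((tendsto_const_nhds (x := x)).sub (e.tendsto_truncation x)).norm.pow 2

lemma abs_integral_sub_integral_truncation_le (hρ : ρ (Metric.closedBall 0 1) = 1) {f : H → ℝ}
    {C : ℝ} (hC : ∀ x, |f x| ≤ C) {L : NNReal} (hL : LipschitzWith L f) {ε : ℝ} (hε : 0 < ε)
    (N : ℕ) :
    |∫ x, f x ∂ρ - ∫ x, f (e.truncation N x) ∂ρ| ≤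
      L * (ε + ε⁻¹ * ∫ x, ‖x - e.truncation N x‖ ^ 2 ∂ρ) := by
  have hT := e.integrable_sq_norm_sub_truncation hρ N
  have hf : Integrable f ρ :=
    .of_bound hL.continuous.aestronglyMeasurable C (.of_forall hC)
  have hfN : Integrable (fun x => f (e.truncation N x)) ρ :=
    .of_bound (hL.continuous.comp (e.continuous_truncation N)).aestronglyMeasurable C
      (.of_forall fun x => hC _)
  have hpt (t : ℝ) : t ≤ ε + ε⁻¹ * t ^ 2 := by
    have h : ε + ε⁻¹ * t ^ 2 - t = ε⁻¹ * ((t - ε / 2) ^ 2 + 3 / 4 * ε ^ 2) := by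
      field_simp
      ring
    have : 0 ≤ ε⁻¹ * ((t - ε / 2) ^ 2 + 3 / 4 * ε ^ 2) := by positivity
    linarith
  rw [← integral_sub hf hfN]
  calc |∫ x, (f x - f (e.truncation N x)) ∂ρ|
      ≤ ∫ x, |f x - f (e.truncation N x)| ∂ρ := abs_integral_le_integral_abs
    _ ≤ ∫ x, L * (ε + ε⁻¹ * ‖x - e.truncation N x‖ ^ 2) ∂ρ := by
        refine integral_mono (hf.sub hfN).abs
          (((integrable_const ε).add (hT.const_mul _)).const_mul _) fun x => ?_
        have h := hL.dist_le_mul x (e.truncation N x)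
        rw [Real.dist_eq, dist_eq_norm] at h
        exact h.trans (mul_le_mul_of_nonneg_left (hpt _) L.coe_nonneg)
    _ = L * (ε + ε⁻¹ * ∫ x, ‖x - e.truncation N x‖ ^ 2 ∂ρ) := by
        rw [integral_const_mul, integral_add (integrable_const ε) (hT.const_mul _),
          integral_const_mul]
        simp

end Measure

end HilbertBasis

/-- **Upgrading weak narrow convergence to strong narrow convergence via uniform
tail convergence.**  Let `(μ n)`, `ν` be Borel probability measures on a
separable complex Hilbert space, concentrated on the closed unit ball, with an
orthonormal basis `(e i)`.  If `μ n → ν` weakly narrowly and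
`sup_N |∫ ∑_{i≥N} |⟨x,e_i⟩|² dμ n - ∫ ∑_{i≥N} |⟨x,e_i⟩|² dν| → 0` as `n → ∞`,
then `μ n → ν` strongly narrowly. -/
theorem weak_narrow_to_strong_narrow_of_uniform_tails
    {H : Type*} [NormedAddCommGroup H] [InnerProductSpace ℂ H] [CompleteSpace H]
    [TopologicalSpace.SeparableSpace H] [MeasurableSpace H] [BorelSpace H]
    (e : HilbertBasis ℕ ℂ H)
    (μ : ℕ → Measure H) (ν : Measure H)
    [∀ n, IsProbabilityMeasure (μ n)] [IsProbabilityMeasure ν]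
    (hμball : ∀ n, μ n (Metric.closedBall 0 1) = 1)
    (hνball : ν (Metric.closedBall 0 1) = 1)
    (hweak : ∀ f : H → ℝ, (∃ C : ℝ, ∀ x, |f x| ≤ C) →
      Continuous (X := WeakSpace ℂ H) f →
      Tendsto (fun n => ∫ x, f x ∂(μ n)) atTop (nhds (∫ x, f x ∂ν)))
    (htail : Tendsto
      (fun n : ℕ => ⨆ N : ℕ,
        |(∫ x, (∑' i : ℕ, if N ≤ i then ‖⟪x, (e i : H)⟫_ℂ‖ ^ 2 else 0) ∂(μ n)) -
          ∫ x, (∑' i : ℕ, if N ≤ i then ‖⟪x, (e i : H)⟫_ℂ‖ ^ 2 else 0) ∂ν|)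
      atTop (nhds 0)) :
    ∀ f : H → ℝ, (∃ C : ℝ, ∀ x, |f x| ≤ C) → Continuous f →
      Tendsto (fun n => ∫ x, f x ∂(μ n)) atTop (nhds (∫ x, f x ∂ν)) := by
  simp only [(e.hasSum_tail_sq_norm_inner _ _).tsum_eq] at htail
  have hT (n N : ℕ) : |∫ x, ‖x - e.truncation N x‖ ^ 2 ∂(μ n) -
      ∫ x, ‖x - e.truncation N x‖ ^ 2 ∂ν| ≤
      ⨆ N : ℕ, |∫ x, ‖x - e.truncation N x‖ ^ 2 ∂(μ n) -
        ∫ x, ‖x - e.truncation N x‖ ^ 2 ∂ν| := by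
    refine le_ciSup (f := fun N : ℕ => |∫ x, ‖x - e.truncation N x‖ ^ 2 ∂(μ n) -
      ∫ x, ‖x - e.truncation N x‖ ^ 2 ∂ν|) ⟨1, ?_⟩ N
    rintro _ ⟨M, rfl⟩
    have h₁ := e.integral_sq_norm_sub_truncation_le_one (hμball n) M
    have h₂ := e.integral_sq_norm_sub_truncation_le_one hνball M
    have h₃ : 0 ≤ ∫ x, ‖x - e.truncation M x‖ ^ 2 ∂(μ n) :=
      integral_nonneg fun x => by positivity
    have h₄ : 0 ≤ ∫ x, ‖x - e.truncation M x‖ ^ 2 ∂ν := integral_nonneg fun x => by positivity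
    exact abs_le.mpr ⟨by linarith, by linarith⟩
  have hlip (f : H → ℝ) (C : ℝ) (hC : ∀ x, |f x| ≤ C) (L : NNReal) (hL : LipschitzWith L f) :
      Tendsto (fun n => ∫ x, f x ∂(μ n)) atTop (nhds (∫ x, f x ∂ν)) := by
    rw [Metric.tendsto_nhds]
    intro δ hδ
    obtain ⟨ε, hε, hLε⟩ : ∃ ε > 0, L * (2 * ε) < δ / 3 := by
      refine ⟨δ / (6 * (L + 1)), by positivity, ?_⟩
      have h : L * (2 * (δ / (6 * (L + 1)))) = δ / 3 * (L / (L + 1) : ℝ) := by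
        field_simp
        ring
      rw [h]
      refine mul_lt_of_lt_one_right (by positivity) ?_
      rw [div_lt_one (by positivity)]
      linarith
    have hbound {t : ℝ} (ht : t ≤ ε ^ 2) : L * (ε + ε⁻¹ * t) < δ / 3 := by
      refine lt_of_le_of_lt (mul_le_mul_of_nonneg_left ?_ L.coe_nonneg) hLε
      have : ε⁻¹ * t ≤ ε⁻¹ * ε ^ 2 := by gcongr
      have : ε⁻¹ * ε ^ 2 = ε := by field_simp
      linarith
    obtain ⟨N, hN⟩ := ((e.tendsto_integral_sq_norm_sub_truncation hνball).eventually_lt_const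
      (by positivity : (0 : ℝ) < ε ^ 2 / 2)).exists
    have hw := hweak (fun x => f (e.truncation N x)) ⟨C, fun x => hC _⟩
      (hL.continuous.comp (e.continuous_weakSpace_truncation N))
    filter_upwards [Metric.tendsto_nhds.mp hw (δ / 3) (by positivity),
      htail.eventually_lt_const (by positivity : (0 : ℝ) < ε ^ 2 / 2)] with n hn hn'
    have hν' := (e.abs_integral_sub_integral_truncation_le hνball hC hL hε N).trans_lt
      (hbound (by linarith [sq_nonneg ε]))
    have hμ' := (e.abs_integral_sub_integral_truncation_le (hμball n) hC hL hε N).trans_lt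
      (hbound (by linarith [(le_abs_self _).trans (hT n N)]))
    rw [Real.dist_eq] at hn ⊢
    rw [abs_lt] at hn hν' hμ' ⊢
    constructor <;> linarith
  let μ' (n : ℕ) : ProbabilityMeasure H := ⟨μ n, inferInstance⟩
  let ν' : ProbabilityMeasure H := ⟨ν, inferInstance⟩
  have hconv : Tendsto μ' atTop (nhds ν') := by
    rw [tendsto_iff_forall_lipschitz_integral_tendsto]
    rintro f ⟨C, hC⟩ ⟨L, hL⟩
    have hb (x : H) : |f x| ≤ |f 0| + C := by
      have h := hC x 0
      rw [Real.dist_eq] at h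
      linarith [abs_sub_abs_le_abs_sub (f x) (f 0)]
    exact hlip f _ hb L hL
  rintro f ⟨C, hC⟩ hf
  exact ProbabilityMeasure.tendsto_iff_forall_integral_tendsto.mp hconv
    (BoundedContinuousFunction.ofNormedAddCommGroup f hf C hC)
end
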